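/- arXiv:1705.02362 — 2 statements merged into one kernel-verified Lean document; each statement's English description precedes it below -/
import Mathlib

section
/- Assume hypotheses (A1), (A2) and (A3). Then for every λ > 0 the Liénard system (S1) has a nonconstant periodic solution, any two nonconstant periodic solutions for the same λ have the same image (denoted Φ(λ)), and the map λ ↦ Φ(λ) is continuous in the Hausdorff distance: for every λ₀ > 0 and every ε > 0 there exists δ > 0 such that for every λ > 0 with |λ − λ₀| < δ, any nonconstant periodic solution of (S1) at parameter λ and any nonconstant periodic solution at parameter λ₀ have images whose Hausdorff distance is less than ε. -/
/-- A nonconstant periodic solution of the Liénard system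
`x' = y, y' = -x - λ f(x) y`. -/
def IsPeriodicSol (f : ℝ → ℝ) (lam : ℝ) (x y : ℝ → ℝ) : Prop :=
  (∃ T : ℝ, 0 < T ∧ ∀ t, x (t + T) = x t ∧ y (t + T) = y t) ∧
  (∀ t, HasDerivAt x (y t) t) ∧
  (∀ t, HasDerivAt y (-(x t) - lam * f (x t) * y t) t) ∧
  (∃ t₁ t₂, (x t₁, y t₁) ≠ (x t₂, y t₂))

open Set Filter Topology Metric
open scoped NNReal

section Semiflow

variable {E : Type*} [NormedAddCommGroup E] [NormedSpace ℝ E]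

/-- `γ` solves the autonomous equation `γ' = v(γ)` on `[0, T]`. -/
def SolvesOn (v : E → E) (γ : ℝ → E) (T : ℝ) : Prop :=
  ∀ t ∈ Icc 0 T, HasDerivWithinAt γ (v (γ t)) (Icc 0 T) t

/-- `γ` solves the autonomous equation `γ' = v(γ)` on `[0, ∞)`. -/
def ForwardSol (v : E → E) (γ : ℝ → E) : Prop :=
  ∀ t, 0 ≤ t → HasDerivWithinAt γ (v (γ t)) (Ici 0) t

lemma SolvesOn.continuousOn {v : E → E} {γ : ℝ → E} {T : ℝ} (h : SolvesOn v γ T) :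
    ContinuousOn γ (Icc 0 T) := fun t ht => (h t ht).continuousWithinAt

lemma SolvesOn.hasDerivWithinAt_Ici {v : E → E} {γ : ℝ → E} {T : ℝ} (h : SolvesOn v γ T)
    {t : ℝ} (ht : t ∈ Ico 0 T) : HasDerivWithinAt γ (v (γ t)) (Ici t) t :=
  (h t ⟨ht.1, ht.2.le⟩).mono_of_mem_nhdsWithin
    (mem_of_superset (Icc_mem_nhdsGE ht.2) (Icc_subset_Icc_left ht.1))

lemma SolvesOn.mono {v : E → E} {γ : ℝ → E} {S T : ℝ} (h : SolvesOn v γ T) (hST : S ≤ T) :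
    SolvesOn v γ S := fun t ht =>
  (h t ⟨ht.1, ht.2.trans hST⟩).mono (Icc_subset_Icc_right hST)

lemma ForwardSol.solvesOn {v : E → E} {γ : ℝ → E} (h : ForwardSol v γ) (T : ℝ) :
    SolvesOn v γ T := fun t ht => (h t ht.1).mono Icc_subset_Ici_self

lemma SolvesOn.congr_field {v w : E → E} {γ : ℝ → E} {T : ℝ} (h : SolvesOn v γ T)
    (hvw : ∀ t ∈ Icc 0 T, w (γ t) = v (γ t)) : SolvesOn w γ T := fun t ht => by
  rw [hvw t ht]; exact h t ht

lemma SolvesOn.dist_le {v : E → E} {K : ℝ≥0} (hv : LipschitzWith K v) {γ₁ γ₂ : ℝ → E} {T : ℝ}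
    (h₁ : SolvesOn v γ₁ T) (h₂ : SolvesOn v γ₂ T) {t : ℝ} (ht : t ∈ Icc 0 T) :
    dist (γ₁ t) (γ₂ t) ≤ dist (γ₁ 0) (γ₂ 0) * Real.exp (K * t) := by
  have := dist_le_of_trajectories_ODE (v := fun _ => v) (fun _ => hv) h₁.continuousOn
    (fun t ht => h₁.hasDerivWithinAt_Ici ht) h₂.continuousOn
    (fun t ht => h₂.hasDerivWithinAt_Ici ht) le_rfl t ht
  simpa using this

/-- Exponential bound for a quantity growing at most linearly along a vector field. -/
lemma SolvesOn.energy_le {v : E → E} {N : E → ℝ} {N' : E → E →L[ℝ] ℝ} {C : ℝ}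
    (hN : ∀ s, HasFDerivAt N (N' s) s) (hv : ∀ s, N' s (v s) ≤ C * N s) {γ : ℝ → E} {T : ℝ}
    (h : SolvesOn v γ T) {t : ℝ} (ht : t ∈ Icc 0 T) :
    N (γ t) ≤ N (γ 0) * Real.exp (C * t) := by
  have key := le_gronwallBound_of_liminf_deriv_right_le (f := fun t => N (γ t))
    (f' := fun t => N' (γ t) (v (γ t))) (δ := N (γ 0)) (K := C) (ε := 0) (a := 0) (b := T)
    (fun t ht => (hN (γ t)).continuousAt.comp_continuousWithinAt (h.continuousOn t ht))
    (fun t ht r hr => by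
      have := ((hN (γ t)).comp_hasDerivWithinAt t (h.hasDerivWithinAt_Ici ht))
      have := this.liminf_right_slope_le hr
      simpa [slope_def_field, div_eq_inv_mul] using this)
    le_rfl (fun t _ => by simpa using hv (γ t)) t ht
  simpa [gronwallBound_ε0] using key

variable [FiniteDimensional ℝ E]

/-- A `C¹` vector field can be cut off outside of a ball to become bounded and Lipschitz. -/
lemma exists_cutoff {v : E → E} (hv : ContDiff ℝ 1 v) (R : ℝ) :
    ∃ (w : E → E) (K : ℝ≥0) (L : ℝ≥0), LipschitzWith K w ∧ (∀ s, ‖w s‖ ≤ L) ∧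
      (∀ s, ‖s‖ ≤ R → w s = v s) ∧ ∀ s, ∃ c : ℝ, 0 ≤ c ∧ c ≤ 1 ∧ w s = c • v s := by
  let χ : ContDiffBump (0 : E) := ⟨max R 1, max R 1 + 1, by positivity, by linarith⟩
  have hsm : ContDiff ℝ 1 (fun s => χ s • v s) := χ.contDiff.smul hv
  have hcs : HasCompactSupport (fun s => χ s • v s) := χ.hasCompactSupport.smul_right
  obtain ⟨K, hK⟩ := hsm.lipschitzWith_of_hasCompactSupport hcs one_ne_zero
  obtain ⟨L, hL⟩ := hcs.exists_bound_of_continuous hsm.continuous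
  refine ⟨_, K, L.toNNReal, hK, fun s => (hL s).trans (Real.le_coe_toNNReal L), ?_,
    fun s => ⟨χ s, χ.nonneg, χ.le_one, rfl⟩⟩
  intro s hs
  have : χ s = 1 := χ.one_of_mem_closedBall (by
    rw [mem_closedBall_zero_iff]; exact hs.trans (le_max_left _ _))
  simp [this]

lemma exists_solvesOn_of_bounded {w : E → E} {K L : ℝ≥0} (hw : LipschitzWith K w)
    (hL : ∀ s, ‖w s‖ ≤ L) (s : E) {T : ℝ} (hT : 0 ≤ T) :
    ∃ γ : ℝ → E, γ 0 = s ∧ SolvesOn w γ T := by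
  have hpl : IsPicardLindelof (fun _ => w) (tmin := 0) (tmax := T) ⟨0, le_rfl, hT⟩ s
      (L * T.toNNReal) 0 L K :=
    IsPicardLindelof.of_time_independent (fun x _ => hL x) hw.lipschitzOnWith
      (by simp [hT])
  exact hpl.exists_eq_forall_mem_Icc_hasDerivWithinAt₀

lemma SolvesOn.eqOn {v : E → E} (hv : ContDiff ℝ 1 v) {γ₁ γ₂ : ℝ → E} {T : ℝ}
    (h₁ : SolvesOn v γ₁ T) (h₂ : SolvesOn v γ₂ T) (h0 : γ₁ 0 = γ₂ 0) :
    EqOn γ₁ γ₂ (Icc 0 T) := by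
  obtain ⟨R₁, hR₁⟩ := isCompact_Icc.exists_bound_of_continuousOn h₁.continuousOn
  obtain ⟨R₂, hR₂⟩ := isCompact_Icc.exists_bound_of_continuousOn h₂.continuousOn
  obtain ⟨w, K, L, hK, -, hw, -⟩ := exists_cutoff hv (max R₁ R₂)
  intro t ht
  have := (h₁.congr_field fun t ht => hw _ ((hR₁ t ht).trans (le_max_left _ _))).dist_le hK
    (h₂.congr_field fun t ht => hw _ ((hR₂ t ht).trans (le_max_right _ _))) ht
  rw [h0, dist_self, zero_mul] at this
  exact dist_le_zero.1 this

lemma ForwardSol.eq {v : E → E} (hv : ContDiff ℝ 1 v) {γ₁ γ₂ : ℝ → E}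
    (h₁ : ForwardSol v γ₁) (h₂ : ForwardSol v γ₂) (h0 : γ₁ 0 = γ₂ 0) {t : ℝ} (ht : 0 ≤ t) :
    γ₁ t = γ₂ t :=
  (h₁.solvesOn t).eqOn hv (h₂.solvesOn t) h0 ⟨ht, le_rfl⟩

variable {v : E → E} {N : E → ℝ} {N' : E → E →L[ℝ] ℝ} {C : ℝ}

lemma exists_forwardSol (hv : ContDiff ℝ 1 v) (hN : ∀ s, HasFDerivAt N (N' s) s)
    (hC : 0 ≤ C) (hN0 : ∀ s, 0 ≤ N s) (hgrow : ∀ s, N' s (v s) ≤ C * N s)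
    (hbdd : ∀ c, ∃ R, ∀ s, N s ≤ c → ‖s‖ ≤ R) (s : E) :
    ∃ γ : ℝ → E, γ 0 = s ∧ ForwardSol v γ := by
  have hloc : ∀ n : ℕ, ∃ γ : ℝ → E, γ 0 = s ∧ SolvesOn v γ n := by
    intro n
    obtain ⟨R, hR⟩ := hbdd (N s * Real.exp (C * n))
    obtain ⟨w, K, L, hK, hL, hw, hc⟩ := exists_cutoff hv R
    obtain ⟨γ, hγ0, hγ⟩ := exists_solvesOn_of_bounded hK hL s (Nat.cast_nonneg n)
    refine ⟨γ, hγ0, hγ.congr_field fun t ht => (hw _ (hR _ ?_)).symm⟩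
    have hgw : ∀ s, N' s (w s) ≤ C * N s := by
      intro s
      obtain ⟨c, hc0, hc1, hcs⟩ := hc s
      rw [hcs, map_smul, smul_eq_mul]
      nlinarith [hgrow s, mul_nonneg hC (hN0 s)]
    have := hγ.energy_le hN hgw ht
    rw [hγ0] at this
    refine this.trans (mul_le_mul_of_nonneg_left (Real.exp_le_exp.2 ?_) (hN0 s))
    exact mul_le_mul_of_nonneg_left ht.2 hC
  choose γ hγ0 hγ using hloc
  have hag : ∀ {m n : ℕ} {t : ℝ}, 0 ≤ t → t ≤ m → t ≤ n → γ m t = γ n t := fun {m n t} h0 hm hn =>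
    ((hγ m).mono hm).eqOn hv ((hγ n).mono hn) ((hγ0 m).trans (hγ0 n).symm) ⟨h0, le_rfl⟩
  refine ⟨fun t => γ ⌈t⌉₊ t, by simp [hγ0], fun t ht => ?_⟩
  set n : ℕ := ⌈t⌉₊ + 1
  have htn : t < n := by push_cast [n]; linarith [Nat.le_ceil t]
  have h1 : HasDerivWithinAt (γ n) (v (γ n t)) (Ici 0) t :=
    ((hγ n) t ⟨ht, htn.le⟩).mono_of_mem_nhdsWithin
      (by rw [← Ici_inter_Iic]
          exact inter_mem self_mem_nhdsWithin (mem_nhdsWithin_of_mem_nhds (Iic_mem_nhds htn)))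
  have h2 : γ ⌈t⌉₊ t = γ n t := hag ht (Nat.le_ceil t) htn.le
  simp only [h2]
  refine h1.congr_of_eventuallyEq ?_ h2
  filter_upwards [self_mem_nhdsWithin, mem_nhdsWithin_of_mem_nhds (Iic_mem_nhds htn)] with u hu hun
  exact hag hu (Nat.le_ceil u) hun

/-- Global forward semiflow of a `C¹` vector field admitting a proper function of controlled
growth, jointly continuous in time and initial condition. -/
theorem exists_semiflow (hv : ContDiff ℝ 1 v) (hN : ∀ s, HasFDerivAt N (N' s) s)
    (hC : 0 ≤ C) (hN0 : ∀ s, 0 ≤ N s) (hgrow : ∀ s, N' s (v s) ≤ C * N s)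
    (hbdd : ∀ c, ∃ R, ∀ s, N s ≤ c → ‖s‖ ≤ R) :
    ∃ φ : ℝ → E → E, (∀ s, φ 0 s = s) ∧ (∀ s, ForwardSol v (fun t => φ t s)) ∧
      Continuous (Function.uncurry φ) := by
  choose γ hγ0 hγ using exists_forwardSol hv hN hC hN0 hgrow hbdd
  refine ⟨fun t s => γ s (max t 0), by simp [hγ0], fun s t ht => ?_, ?_⟩
  · simp only [max_eq_left ht]
    exact (hγ s t ht).congr (fun u hu => by rw [max_eq_left hu]) (by rw [max_eq_left ht])
  rw [continuous_iff_continuousAt]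
  rintro ⟨t₀, s₀⟩
  set T := max t₀ 0 + 1 with hT
  have hT0 : 0 ≤ T := by positivity
  obtain ⟨R, hR⟩ := hbdd ((N s₀ + 1) * Real.exp (C * T))
  obtain ⟨w, K, L, hK, -, hw, -⟩ := exists_cutoff hv R
  have hsol : ∀ s, N s < N s₀ + 1 → SolvesOn w (γ s) T := fun s hs =>
    ((hγ s).solvesOn T).congr_field fun t ht => hw _ <| hR _ <| by
      refine (((hγ s).solvesOn T).energy_le hN hgrow ht).trans ?_
      rw [hγ0]
      have : Real.exp (C * t) ≤ Real.exp (C * T) :=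
        Real.exp_le_exp.2 (mul_le_mul_of_nonneg_left ht.2 hC)
      exact mul_le_mul hs.le this (Real.exp_pos _).le (by linarith [hN0 s₀])
  have hcont₀ : Continuous fun t => γ s₀ (max t 0) := by
    have : ContinuousOn (γ s₀) (Ici 0) := fun t ht => (hγ s₀ t ht).continuousWithinAt
    exact this.comp_continuous (by fun_prop) fun t => mem_Ici.2 (le_max_right _ _)
  rw [ContinuousAt, tendsto_iff_dist_tendsto_zero]
  have hlim : Tendsto (fun q : ℝ × E => dist q.2 s₀ * Real.exp (K * T) +
      dist (γ s₀ (max q.1 0)) (γ s₀ (max t₀ 0))) (𝓝 (t₀, s₀)) (𝓝 0) := by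
    have : Continuous (fun q : ℝ × E => dist q.2 s₀ * Real.exp (K * T) +
      dist (γ s₀ (max q.1 0)) (γ s₀ (max t₀ 0))) :=
      ((continuous_snd.dist continuous_const).mul continuous_const).add
        ((hcont₀.comp continuous_fst).dist continuous_const)
    simpa using this.tendsto (t₀, s₀)
  refine squeeze_zero' (Eventually.of_forall fun _ => dist_nonneg) ?_ hlim
  have hNc : Continuous N := continuous_iff_continuousAt.2 fun s => (hN s).continuousAt
  have e1 : ∀ᶠ q : ℝ × E in 𝓝 (t₀, s₀), N q.2 < N s₀ + 1 :=
    (hNc.comp continuous_snd).continuousAt.eventually_lt continuousAt_const (by simp)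
  have e2 : ∀ᶠ q : ℝ × E in 𝓝 (t₀, s₀), max q.1 0 < T :=
    ((continuous_fst.max continuous_const).continuousAt).eventually_lt continuousAt_const
      (by simp [hT])
  filter_upwards [e1, e2] with q h1 h2
  refine (dist_triangle _ (γ s₀ (max q.1 0)) _).trans (add_le_add ?_ le_rfl)
  have := (hsol q.2 h1).dist_le hK (hsol s₀ (by simp)) (t := max q.1 0) ⟨le_max_right _ _, h2.le⟩
  rw [hγ0, hγ0] at this
  refine this.trans (mul_le_mul_of_nonneg_left (Real.exp_le_exp.2 ?_) dist_nonneg)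
  exact mul_le_mul_of_nonneg_left h2.le K.2

end Semiflow

section Monotonicity

variable {u u' : ℝ → ℝ} {a c e : ℝ}

lemma continuousOn_of_hasDerivWithinAt_Ici
    (h : ∀ t, 0 ≤ t → HasDerivWithinAt u (u' t) (Ici 0) t) : ContinuousOn u (Ici 0) :=
  fun t ht => (h t ht).continuousWithinAt

lemma le_of_hasDerivWithinAt_nonneg (h : ∀ t, 0 ≤ t → HasDerivWithinAt u (u' t) (Ici 0) t)
    (ha : 0 ≤ a) (hac : a ≤ c) (hpos : ∀ t ∈ Ioo a c, 0 ≤ u' t) : u a ≤ u c := by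
  have hd : ∀ t ∈ Ioo a c, HasDerivAt u (u' t) t := fun t ht =>
    (h t (ha.trans ht.1.le)).hasDerivAt (Ici_mem_nhds (ha.trans_lt ht.1))
  refine monotoneOn_of_deriv_nonneg (convex_Icc a c)
    ((continuousOn_of_hasDerivWithinAt_Ici h).mono fun t ht => ha.trans ht.1) ?_ ?_
    ⟨le_rfl, hac⟩ ⟨hac, le_rfl⟩ hac
  · rw [interior_Icc]
    exact fun t ht => (hd t ht).differentiableAt.differentiableWithinAt
  · rw [interior_Icc]
    exact fun t ht => (hd t ht).deriv ▸ hpos t ht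

lemma lt_of_hasDerivWithinAt_pos (h : ∀ t, 0 ≤ t → HasDerivWithinAt u (u' t) (Ici 0) t)
    (ha : 0 ≤ a) (hac : a < c) (hpos : ∀ t ∈ Ioo a c, 0 < u' t) : u a < u c := by
  have hd : ∀ t ∈ Ioo a c, HasDerivAt u (u' t) t := fun t ht =>
    (h t (ha.trans ht.1.le)).hasDerivAt (Ici_mem_nhds (ha.trans_lt ht.1))
  refine strictMonoOn_of_deriv_pos (convex_Icc a c)
    ((continuousOn_of_hasDerivWithinAt_Ici h).mono fun t ht => ha.trans ht.1) ?_
    ⟨le_rfl, hac.le⟩ ⟨hac.le, le_rfl⟩ hac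
  rw [interior_Icc]
  exact fun t ht => (hd t ht).deriv ▸ hpos t ht

/-- A level that cannot be crossed downwards. -/
lemma le_of_forall_lt_imp_nonneg (h : ∀ t, 0 ≤ t → HasDerivWithinAt u (u' t) (Ici 0) t)
    (ha : 0 ≤ a) (hac : a ≤ c) (hea : e ≤ u a)
    (hpos : ∀ t ∈ Icc a c, u t < e → 0 ≤ u' t) : e ≤ u c := by
  by_contra! hlt
  have hcont : ContinuousOn u (Icc a c) :=
    (continuousOn_of_hasDerivWithinAt_Ici h).mono fun t ht => ha.trans ht.1
  have hcl : IsClosed (Icc a c ∩ u ⁻¹' Ici e) :=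
    hcont.preimage_isClosed_of_isClosed isClosed_Icc isClosed_Ici
  obtain ⟨s, ⟨hs, hse⟩, hmax⟩ := (isCompact_Icc.of_isClosed_subset hcl
    inter_subset_left).exists_isGreatest ⟨a, ⟨le_rfl, hac⟩, hea⟩
  have := le_of_hasDerivWithinAt_nonneg h (ha.trans hs.1) hs.2 fun t ht =>
    hpos t ⟨hs.1.trans ht.1.le, ht.2.le⟩ (by
      by_contra! hle
      exact absurd (hmax ⟨⟨hs.1.trans ht.1.le, ht.2.le⟩, hle⟩) (not_le.2 ht.1))
  exact absurd (hse.out.trans this) (not_le.2 hlt)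

/-- If `u` starts above a level above which it is nondecreasing, it never goes below its
initial value. -/
lemma le_of_forall_gt_imp_nonneg (h : ∀ t, 0 ≤ t → HasDerivWithinAt u (u' t) (Ici 0) t)
    (ha : 0 ≤ a) (hac : a ≤ c) (hea : e < u a)
    (hpos : ∀ t ∈ Icc a c, e < u t → 0 ≤ u' t) : u a ≤ u c := by
  have hcont : ContinuousOn u (Icc a c) :=
    (continuousOn_of_hasDerivWithinAt_Ici h).mono fun t ht => ha.trans ht.1
  have hcl : IsClosed (Icc a c ∩ u ⁻¹' Iic e) :=
    hcont.preimage_isClosed_of_isClosed isClosed_Icc isClosed_Iic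
  rcases (Icc a c ∩ u ⁻¹' Iic e).eq_empty_or_nonempty with hem | hne
  · refine le_of_hasDerivWithinAt_nonneg h ha hac fun t ht => hpos t ⟨ht.1.le, ht.2.le⟩ ?_
    by_contra! hle
    exact (hem ▸ (⟨⟨ht.1.le, ht.2.le⟩, hle⟩ : t ∈ Icc a c ∩ u ⁻¹' Iic e) : t ∈ (∅ : Set ℝ))
  obtain ⟨s, ⟨hs, hse⟩, hmin⟩ := (isCompact_Icc.of_isClosed_subset hcl
    inter_subset_left).exists_isLeast hne
  have := le_of_hasDerivWithinAt_nonneg h ha hs.1 fun t ht =>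
    hpos t ⟨ht.1.le, ht.2.le.trans hs.2⟩ (by
      by_contra! hle
      exact absurd (hmin ⟨⟨ht.1.le, ht.2.le.trans hs.2⟩, hle⟩) (not_le.2 ht.2))
  exact absurd (this.trans hse.out) (not_le.2 hea)

end Monotonicity

/-- `(x, z)` solves the Liénard system `x' = z - λ F(x)`, `z' = -x` on `[0, ∞)`. -/
def LienardSol (F : ℝ → ℝ) (lam : ℝ) (x z : ℝ → ℝ) : Prop :=
  ∀ t, 0 ≤ t → HasDerivWithinAt x (z t - lam * F (x t)) (Ici 0) t ∧
    HasDerivWithinAt z (-(x t)) (Ici 0) t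

/-- Sign and size conditions on `F` of Dragilev type; they are invariant under
`F ↦ (x ↦ -F (-x))`. -/
structure DragilevShape (F : ℝ → ℝ) (b m k B : ℝ) : Prop where
  contDiff : ContDiff ℝ 1 F
  zero : F 0 = 0
  b_pos : 0 < b
  m_pos : 0 < m
  k_pos : 0 < k
  B_pos : 0 < B
  mul_neg : ∀ x, |x| ≤ b → x ≠ 0 → x * F x < 0
  neg_m_le : ∀ x, 0 ≤ x → -m ≤ F x
  le_m : ∀ x, x ≤ 0 → F x ≤ m
  k_le : ∀ x, B ≤ x → k ≤ F x
  le_neg_k : ∀ x, x ≤ -B → F x ≤ -k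

namespace DragilevShape

variable {F : ℝ → ℝ} {b m k B : ℝ}

lemma reflect (hF : DragilevShape F b m k B) : DragilevShape (fun x => -F (-x)) b m k B where
  contDiff := (hF.contDiff.comp contDiff_neg).neg
  zero := by simp [hF.zero]
  b_pos := hF.b_pos
  m_pos := hF.m_pos
  k_pos := hF.k_pos
  B_pos := hF.B_pos
  mul_neg x hx hx0 := by
    have := hF.mul_neg (-x) (by rwa [abs_neg]) (by simpa using hx0)
    linarith
  neg_m_le x hx := by linarith [hF.le_m (-x) (by linarith)]
  le_m x hx := by linarith [hF.neg_m_le (-x) (by linarith)]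
  k_le x hx := by linarith [hF.le_neg_k (-x) (by linarith)]
  le_neg_k x hx := by linarith [hF.k_le (-x) (by linarith)]

lemma neg_mul_le (hF : DragilevShape F b m k B) (x : ℝ) : -(x * F x) ≤ B * m := by
  have hB := hF.B_pos
  have hm := hF.m_pos
  have hk := hF.k_pos
  rcases le_total 0 x with hx | hx
  · rcases le_total B x with h | h
    · nlinarith [hF.k_le x h]
    · nlinarith [hF.neg_m_le x hx, mul_nonneg hx hm.le]
  · rcases le_total x (-B) with h | h
    · nlinarith [hF.le_neg_k x h]
    · nlinarith [hF.le_m x hx, mul_nonneg (neg_nonneg.2 hx) hm.le]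

lemma continuous (hF : DragilevShape F b m k B) : Continuous F := hF.contDiff.continuous

lemma mul_nonpos (hF : DragilevShape F b m k B) {x : ℝ} (hx : |x| ≤ b) : x * F x ≤ 0 := by
  rcases eq_or_ne x 0 with rfl | h
  · simp
  · exact (hF.mul_neg x hx h).le

end DragilevShape

namespace LienardSol

variable {F : ℝ → ℝ} {b m k B lam : ℝ} {x z : ℝ → ℝ}

lemma continuousOn_fst (h : LienardSol F lam x z) : ContinuousOn x (Ici 0) :=
  fun t ht => (h t ht).1.continuousWithinAt

lemma continuousOn_snd (h : LienardSol F lam x z) : ContinuousOn z (Ici 0) :=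
  fun t ht => (h t ht).2.continuousWithinAt

lemma continuousOn_deriv (hF : Continuous F) (h : LienardSol F lam x z) :
    ContinuousOn (fun t => z t - lam * F (x t)) (Ici 0) :=
  h.continuousOn_snd.sub (continuousOn_const.mul (hF.comp_continuousOn h.continuousOn_fst))

lemma shift (h : LienardSol F lam x z) {s : ℝ} (hs : 0 ≤ s) :
    LienardSol F lam (fun t => x (t + s)) (fun t => z (t + s)) := by
  intro t ht
  have hm : MapsTo (fun t => t + s) (Ici 0) (Ici 0) := fun t ht =>
    add_nonneg (mem_Ici.1 ht) hs
  have hd : HasDerivWithinAt (fun t => t + s) 1 (Ici 0) t :=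
    (hasDerivAt_id t).add_const s |>.hasDerivWithinAt
  have h1 := (h (t + s) (by linarith)).1.scomp t hd hm
  have h2 := (h (t + s) (by linarith)).2.scomp t hd hm
  simp only [one_smul] at h1 h2
  exact ⟨h1, h2⟩

lemma reflect (h : LienardSol F lam x z) :
    LienardSol (fun x => -F (-x)) lam (fun t => -x t) (fun t => -z t) := by
  intro t ht
  refine ⟨(h t ht).1.neg.congr_deriv ?_, (h t ht).2.neg.congr_deriv ?_⟩
  · simp; ring
  · ring

lemma hasDerivWithinAt_energy (h : LienardSol F lam x z) {t : ℝ} (ht : 0 ≤ t) :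
    HasDerivWithinAt (fun t => x t ^ 2 + z t ^ 2) (-(2 * lam * (x t * F (x t)))) (Ici 0) t := by
  refine (((h t ht).1.pow 2).add ((h t ht).2.pow 2)).congr_deriv ?_
  push_cast; ring

/-- Discs contained in the region where the damping is negative have forward invariant
complement. -/
lemma le_energy (hF : DragilevShape F b m k B) (hlam : 0 ≤ lam) (h : LienardSol F lam x z)
    {e a c : ℝ} (heb : e ≤ b ^ 2) (ha : 0 ≤ a) (hac : a ≤ c) (hea : e ≤ x a ^ 2 + z a ^ 2) :
    e ≤ x c ^ 2 + z c ^ 2 := by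
  refine le_of_forall_lt_imp_nonneg (u := fun t => x t ^ 2 + z t ^ 2)
    (fun t ht => h.hasDerivWithinAt_energy ht) ha hac hea fun t ht hlt => ?_
  have hxb : |x t| ≤ b := abs_le_of_sq_le_sq (by nlinarith [sq_nonneg (z t)]) hF.b_pos.le
  nlinarith [hF.mul_nonpos hxb]

lemma snd_anti (h : LienardSol F lam x z) {a c : ℝ} (ha : 0 ≤ a) (hac : a ≤ c)
    (hx : ∀ t ∈ Ioo a c, 0 ≤ x t) : z c ≤ z a := by
  have := le_of_hasDerivWithinAt_nonneg (u := fun t => -z t) (u' := fun t => x t)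
    (fun t ht => (h t ht).2.neg.congr_deriv (by ring)) ha hac hx
  linarith

/-- In the right half plane the distance to `(0, -λ m)` decreases. -/
lemma shifted_energy_anti (hF : DragilevShape F b m k B) (hlam : 0 ≤ lam)
    (h : LienardSol F lam x z) {a c : ℝ} (ha : 0 ≤ a) (hac : a ≤ c)
    (hx : ∀ t ∈ Ioo a c, 0 ≤ x t) :
    x c ^ 2 + (z c + lam * m) ^ 2 ≤ x a ^ 2 + (z a + lam * m) ^ 2 := by
  have := le_of_hasDerivWithinAt_nonneg (u := fun t => -(x t ^ 2 + (z t + lam * m) ^ 2))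
    (u' := fun t => 2 * (lam * (x t * (F (x t) + m))))
    (fun t ht => by
      refine (((h t ht).1.pow 2).add (((h t ht).2.add_const (lam * m)).pow 2)).neg.congr_deriv ?_
      push_cast; ring) ha hac
    (fun t ht => by
      have := hF.neg_m_le _ (hx t ht)
      have := hx t ht
      have : 0 ≤ F (x t) + m := by linarith
      positivity)
  linarith

lemma exists_pos_near (hF : Continuous F) (h : LienardSol F lam x z) (hF0 : F 0 = 0)
    (hx0 : x 0 = 0) (hz0 : 0 < z 0) : ∃ η > 0, ∀ t ∈ Ioc 0 η, 0 < x t := by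
  have hc := h.continuousOn_deriv hF 0 self_mem_Ici
  have hpos : ∀ᶠ t in 𝓝[≥] 0, 0 < z t - lam * F (x t) :=
    hc.eventually_const_lt (by simpa [hx0, hF0] using hz0)
  obtain ⟨η, hη, hsub⟩ := mem_nhdsGE_iff_exists_Ico_subset.1 hpos
  refine ⟨η, hη, fun t ht => ?_⟩
  have := lt_of_hasDerivWithinAt_pos (fun t ht => (h t ht).1) le_rfl ht.1
    fun s hs => hsub ⟨hs.1.le, hs.2.trans_le ht.2⟩
  linarith

lemma exists_nonpos (hF : DragilevShape F b m k B) (hlam : 0 ≤ lam) (h : LienardSol F lam x z)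
    (hx0 : x 0 = 0) (hz0 : 0 < z 0) : ∃ t > 0, x t ≤ 0 := by
  by_contra! hx
  have hb := hF.b_pos
  have hm := hF.m_pos
  set e := min (z 0 ^ 2) (b ^ 2) with he
  have he0 : 0 < e := by positivity
  have hE : ∀ t, 0 ≤ t → e ≤ x t ^ 2 + z t ^ 2 := fun t ht =>
    h.le_energy hF hlam (min_le_right _ _) le_rfl ht (by rw [hx0]; simp [he])
  have hzlow : ∀ t, 0 ≤ t → -(z 0 + 2 * (lam * m)) ≤ z t := fun t ht => by
    have h1 := h.shifted_energy_anti hF hlam le_rfl ht fun s hs => (hx s hs.1).le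
    rw [hx0] at h1
    have : 0 ≤ lam * m := by positivity
    have := abs_le_of_sq_le_sq (a := z t + lam * m) (b := z 0 + lam * m)
      (by nlinarith [sq_nonneg (x t)]) (by linarith)
    linarith [(abs_le.1 this).1]
  set c := √(e / 2) with hcdef
  have hc0 : 0 < c := by positivity
  have hc2 : c ^ 2 = e / 2 := Real.sq_sqrt (by positivity)
  have hFs : ∀ᶠ y in 𝓝 (0 : ℝ), |lam * F y| < c / 2 :=
    ((continuous_const.mul hF.continuous).abs.continuousAt (x := (0:ℝ))).eventually_lt
      continuousAt_const (by simpa [hF.zero] using hc0)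
  obtain ⟨d, hd0, hd⟩ := Metric.eventually_nhds_iff.1 hFs
  set δ := min (min (d / 2) c) (x 1) with hδ
  have hδ0 : 0 < δ := by have := hx 1 one_pos; positivity
  have hsmall : ∀ t, 0 < t → x t < δ → c ≤ |z t| ∧ |lam * F (x t)| < c / 2 := by
    intro t ht hxt
    have hpos := hx t ht
    have h1 : x t < d / 2 := hxt.trans_le ((min_le_left _ _).trans (min_le_left _ _))
    have h2 : x t < c := hxt.trans_le ((min_le_left _ _).trans (min_le_right _ _))
    refine ⟨(sq_le_sq₀ hc0.le (abs_nonneg _)).1 ?_, hd ?_⟩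
    · rw [sq_abs]
      nlinarith [hE t ht.le]
    · rw [Real.dist_eq, sub_zero, abs_of_pos hpos]; linarith
  have hxδ : ∀ t, 1 ≤ t → δ ≤ x t := by
    intro t ht
    by_contra! hlt
    rcases le_or_gt 0 (z t) with hz | hz
    · refine absurd (le_of_forall_lt_imp_nonneg (fun t ht => (h t ht).1) zero_le_one ht
        (min_le_right _ _) fun s hs hsδ => ?_) (not_le.2 hlt)
      have hs0 : 0 < s := one_pos.trans_le hs.1
      obtain ⟨h1, h2⟩ := hsmall s hs0 hsδ
      have hzs : z t ≤ z s := h.snd_anti hs0.le hs.2 fun r hr => (hx r (hs0.trans hr.1)).le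
      rw [abs_of_nonneg (hz.trans hzs)] at h1
      linarith [(abs_lt.1 h2).2]
    · have ht0 : 0 < t := one_pos.trans_le ht
      have hder : ∀ s, t ≤ s → x s < δ → z s - lam * F (x s) ≤ -(c / 2) := by
        intro s hs hsδ
        have hs0 : 0 < s := ht0.trans_le hs
        obtain ⟨h1, h2⟩ := hsmall s hs0 hsδ
        have hzs : z s ≤ z t := h.snd_anti ht0.le hs fun r hr => (hx r (ht0.trans hr.1)).le
        rw [abs_of_neg (hzs.trans_lt hz)] at h1
        linarith [(abs_lt.1 h2).1]
      have hstay : ∀ s, t ≤ s → x s < δ := by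
        intro s hs
        have := le_of_forall_gt_imp_nonneg (u := fun t => -x t) (e := -δ)
          (fun t ht => (h t ht).1.neg) ht0.le hs (by linarith) fun r hr hrδ => by
            have := hder r hr.1 (by linarith)
            linarith
        linarith
      set s := t + 2 * x t / c with hs
      have hts : t ≤ s := by have := hx t ht0; rw [hs]; linarith [show 0 ≤ 2 * x t / c by positivity]
      have := le_of_hasDerivWithinAt_nonneg (u := fun t => -x t - c / 2 * t)
        (fun t ht => (h t ht).1.neg.sub ((hasDerivWithinAt_id t _).const_mul (c / 2))) ht0.le hts
        fun r hr => by
          have := hder r hr.1.le (hstay r hr.1.le)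
          linarith
      have hxs := hx s (ht0.trans_le hts)
      have : c / 2 * s = c / 2 * t + x t := by rw [hs]; field_simp
      linarith
  set s := 1 + (2 * z 0 + 2 * (lam * m) + 1) / δ with hs
  have hq : 0 ≤ (2 * z 0 + 2 * (lam * m) + 1) / δ := by positivity
  have h1s : 1 ≤ s := by linarith
  have h1 := le_of_hasDerivWithinAt_nonneg (u := fun t => -z t - δ * t)
    (fun t ht => (h t ht).2.neg.sub ((hasDerivWithinAt_id t _).const_mul δ)) zero_le_one h1s
    fun r hr => by linarith [hxδ r hr.1.le]
  have h2 : δ * s = δ + (2 * z 0 + 2 * (lam * m) + 1) := by rw [hs]; field_simp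
  have h3 : z 1 ≤ z 0 := h.snd_anti le_rfl zero_le_one fun r hr => (hx r hr.1).le
  have h4 := hzlow s (by linarith)
  linarith

/-- A solution starting on the positive `z`-axis crosses the right half plane and reaches the
negative `z`-axis. -/
lemma exists_return (hF : DragilevShape F b m k B) (hlam : 0 ≤ lam) (h : LienardSol F lam x z)
    (hx0 : x 0 = 0) (hz0 : 0 < z 0) :
    ∃ τ > 0, (∀ t ∈ Ioo 0 τ, 0 < x t) ∧ x τ = 0 ∧ z τ < 0 := by
  obtain ⟨η, hη, hpos⟩ := h.exists_pos_near hF.continuous hF.zero hx0 hz0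
  obtain ⟨t₁, ht₁, hxt₁⟩ := h.exists_nonpos hF hlam hx0 hz0
  have hηt : η ≤ t₁ := by
    by_contra! hlt
    exact absurd (hpos t₁ ⟨ht₁, hlt.le⟩) (not_lt.2 hxt₁)
  have hcl : IsClosed (Icc η t₁ ∩ x ⁻¹' Iic 0) :=
    (h.continuousOn_fst.mono fun t ht => hη.le.trans ht.1).preimage_isClosed_of_isClosed
      isClosed_Icc isClosed_Iic
  obtain ⟨τ, ⟨hτ, hτx⟩, hmin⟩ := (isCompact_Icc.of_isClosed_subset hcl
    inter_subset_left).exists_isLeast ⟨t₁, ⟨hηt, le_rfl⟩, hxt₁⟩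
  have hτ0 : 0 < τ := hη.trans_le hτ.1
  have hin : ∀ t ∈ Ioo 0 τ, 0 < x t := by
    intro t ht
    rcases le_total t η with hle | hle
    · exact hpos t ⟨ht.1, hle⟩
    · by_contra! hn
      exact absurd (hmin ⟨⟨hle, ht.2.le.trans hτ.2⟩, hn⟩) (not_le.2 ht.2)
  have hxat : ContinuousAt x τ := (h.continuousOn_fst τ hτ0.le).continuousAt (Ici_mem_nhds hτ0)
  have hτ0' : x τ = 0 := by
    have hleft : Tendsto x (𝓝[<] τ) (𝓝 (x τ)) := hxat.tendsto.mono_left nhdsWithin_le_nhds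
    refine le_antisymm hτx (ge_of_tendsto hleft ?_)
    filter_upwards [Ioo_mem_nhdsLT hτ0] with t ht using (hin t ht).le
  refine ⟨τ, hτ0, hin, hτ0', ?_⟩
  have hne : z τ ≠ 0 := by
    intro hz
    have := h.le_energy hF hlam (e := min (z 0 ^ 2) (b ^ 2)) (min_le_right _ _) le_rfl hτ0.le
      (by rw [hx0]; simp)
    rw [hτ0', hz] at this
    have hb := hF.b_pos
    have : 0 < min (z 0 ^ 2) (b ^ 2) := by positivity
    linarith
  refine lt_of_le_of_ne (le_of_not_gt fun hgt => ?_) hne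
  have hdc : ContinuousAt (fun t => z t - lam * F (x t)) τ :=
    (h.continuousOn_deriv hF.continuous τ hτ0.le).continuousAt (Ici_mem_nhds hτ0)
  have hev : ∀ᶠ t in 𝓝 τ, 0 < z t - lam * F (x t) :=
    hdc.eventually_const_lt (by simpa [hτ0', hF.zero] using hgt)
  obtain ⟨l, hl, hsub⟩ := (mem_nhdsLE_iff_exists_Ioc_subset' hτ0).1 (mem_nhdsWithin_of_mem_nhds hev)
  have hl' : max l (τ / 2) < τ := max_lt hl (by linarith)
  have hl0 : 0 < max l (τ / 2) := by positivity
  have := lt_of_hasDerivWithinAt_pos (fun t ht => (h t ht).1) hl0.le hl'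
    fun s hs => hsub ⟨(le_max_left _ _).trans_lt hs.1, hs.2.le⟩
  linarith [hin _ ⟨hl0, hl'⟩]

end LienardSol

/-- A `C¹` function vanishing to the right of `c` whose derivative `max 0 (c - x)` is positive to
the left of `c`. -/
lemma hasDerivAt_neg_sq_max_div_two (c x : ℝ) :
    HasDerivAt (fun x => -(max 0 (c - x) ^ 2 / 2)) (max 0 (c - x)) x := by
  rcases lt_trichotomy x c with hx | hx | hx
  · have h1 : HasDerivAt (fun x => -((c - x) ^ 2 / 2)) (max 0 (c - x)) x := by
      refine (((((hasDerivAt_id x).const_sub c).pow 2).div_const 2).neg).congr_deriv ?_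
      rw [max_eq_right (by linarith)]; simp; ring
    refine h1.congr_of_eventuallyEq ?_
    filter_upwards [Iio_mem_nhds hx] with y hy
    rw [max_eq_right (by linarith [mem_Iio.1 hy])]
  · subst hx
    have h0 : (0 : ℝ) = max 0 (x - x) := by simp
    rw [← h0, hasDerivAt_iff_isLittleO]
    have : (fun y => (y - x) ^ 2) =o[𝓝 x] fun y => y - x := by
      simpa using Asymptotics.isLittleO_pow_sub_sub x one_lt_two
    refine Asymptotics.IsBigO.trans_isLittleO (Asymptotics.IsBigO.of_bound 1 ?_) this
    refine Eventually.of_forall fun y => ?_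
    simp only [sub_self, max_self, smul_zero, sub_zero, Real.norm_eq_abs, one_mul]
    rw [abs_pow, sq_abs]
    rcases le_total y x with h | h
    · rw [max_eq_right (by linarith), abs_le]; constructor <;> nlinarith [sq_nonneg (x - y)]
    · rw [max_eq_left (by linarith), abs_le]; constructor <;> nlinarith [sq_nonneg (x - y)]
  · have h1 : HasDerivAt (fun _ : ℝ => (0 : ℝ)) (max 0 (c - x)) x := by
      rw [max_eq_left (by linarith)]; exact hasDerivAt_const _ _
    refine h1.congr_of_eventuallyEq ?_
    filter_upwards [Ioi_mem_nhds hx] with y hy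
    rw [max_eq_left (by linarith [mem_Ioi.1 hy])]; simp

namespace LienardSol

variable {F : ℝ → ℝ} {b m k B lam : ℝ} {x z : ℝ → ℝ}

lemma return_le (hF : DragilevShape F b m k B) (hlam : 0 ≤ lam) (h : LienardSol F lam x z)
    (hx0 : x 0 = 0) (hz0 : 0 < z 0) {τ : ℝ} (hτ : 0 < τ) (hx : ∀ t ∈ Ioo 0 τ, 0 < x t)
    (hxτ : x τ = 0) : -z τ ≤ z 0 + 2 * (lam * m) := by
  have h1 := h.shifted_energy_anti hF hlam le_rfl hτ.le fun t ht => (hx t ht).le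
  have := hF.m_pos
  have : 0 ≤ lam * m := by positivity
  rw [hx0, hxτ] at h1
  have := abs_le_of_sq_le_sq (a := z τ + lam * m) (b := z 0 + lam * m) (by linarith) (by linarith)
  linarith [(abs_le.1 this).1]

lemma min_le_return (hF : DragilevShape F b m k B) (hlam : 0 ≤ lam) (h : LienardSol F lam x z)
    (hx0 : x 0 = 0) (hz0 : 0 < z 0) {τ : ℝ} (hτ : 0 < τ)
    (hxτ : x τ = 0) (hzτ : z τ < 0) : min (z 0) b ≤ -z τ := by
  have hb := hF.b_pos
  have hmin : 0 < min (z 0) b := lt_min hz0 hb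
  have h1 := h.le_energy hF hlam (e := min (z 0) b ^ 2)
    (pow_le_pow_left₀ hmin.le (min_le_right _ _) 2) le_rfl hτ.le
    (by rw [hx0]; nlinarith [min_le_left (z 0) b])
  rw [hxτ] at h1
  exact abs_le_of_sq_le_sq (by linarith) (by linarith) |> (le_abs_self _).trans

lemma lt_return (hF : DragilevShape F b m k B) (hlam : 0 < lam) (h : LienardSol F lam x z)
    (hx0 : x 0 = 0) (hz0 : 0 < z 0) {τ : ℝ} (hτ : 0 < τ) (hx : ∀ t ∈ Ioo 0 τ, 0 < x t)
    (hxτ : x τ = 0) (hzτ : z τ < 0) (hzb : z 0 < b) : z 0 < -z τ := by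
  have hb := hF.b_pos
  have hev : ∀ᶠ t in 𝓝[≥] 0, x t < b :=
    (h.continuousOn_fst 0 self_mem_Ici).eventually_lt_const (by rw [hx0]; exact hb)
  obtain ⟨η, hη, hsub⟩ := mem_nhdsGE_iff_exists_Ico_subset.1 hev
  set t₁ := min η τ with ht₁
  have ht₁0 : 0 < t₁ := lt_min hη hτ
  have h1 := lt_of_hasDerivWithinAt_pos (u := fun t => x t ^ 2 + z t ^ 2)
    (fun t ht => h.hasDerivWithinAt_energy ht) le_rfl ht₁0 fun t ht => by
      have hpos := hx t ⟨ht.1, ht.2.trans_le (min_le_right _ _)⟩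
      have hltb : x t < b := hsub ⟨ht.1.le, ht.2.trans_le (min_le_left _ _)⟩
      have := hF.mul_neg (x t) (by rw [abs_of_pos hpos]; exact hltb.le) hpos.ne'
      nlinarith
  have h2 := h.le_energy hF hlam.le (e := min (x t₁ ^ 2 + z t₁ ^ 2) (b ^ 2)) (min_le_right _ _)
    ht₁0.le (min_le_right η τ) (min_le_left _ _)
  simp only [hx0] at h1
  have h3 : z 0 ^ 2 < min (x t₁ ^ 2 + z t₁ ^ 2) (b ^ 2) := lt_min (by linarith) (by nlinarith)
  rw [hxτ] at h2
  exact lt_of_pow_lt_pow_left₀ 2 (by linarith) (by linarith)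

/-- Large excursions in the right half plane lose energy. -/
lemma return_lt (hF : DragilevShape F b m k B) (hlam : 0 < lam) (h : LienardSol F lam x z)
    (hx0 : x 0 = 0) {A : ℝ} (hA0 : 0 ≤ A) (hA : ∀ y ∈ Icc 0 (B + 1), |F y| ≤ A)
    (hbig : 2 * (lam * m) + lam * (m + k) * B + lam * A + (B + 1) ≤ z 0)
    (hbig' : (B + 1) ^ 2 < 2 * (lam * k) * z 0)
    {τ : ℝ} (hτ : 0 < τ) (hx : ∀ t ∈ Ioo 0 τ, 0 < x t)
    (hxτ : x τ = 0) (hzτ : z τ < 0) : -z τ < z 0 := by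
  by_contra! hge
  have hb := hF.b_pos
  have hm := hF.m_pos
  have hk := hF.k_pos
  have hB := hF.B_pos
  have hlm : 0 < lam * m := by positivity
  have hlA : 0 ≤ lam * A := by positivity
  have hlB : 0 < lam * (m + k) * B := by positivity
  have hlk : 0 < lam * k := by positivity
  have hz0 : 0 < z 0 := by linarith
  have hxnn : ∀ t ∈ Icc 0 τ, 0 ≤ x t := by
    intro t ht
    rcases eq_or_lt_of_le ht.1 with rfl | h0
    · exact hx0.ge
    rcases eq_or_lt_of_le ht.2 with rfl | h1
    · exact hxτ.ge
    exact (hx t ⟨h0, h1⟩).le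
  have hann : ∀ t ∈ Icc 0 τ, x t ≤ B + 1 →
      (lam * m + lam * (m + k) * B + lam * A) ^ 2 ≤ (z t + lam * m) ^ 2 := by
    intro t ht hxB
    have h1 := h.shifted_energy_anti hF hlam.le ht.1 ht.2 fun s hs =>
      (hx s ⟨ht.1.trans_lt hs.1, hs.2⟩).le
    rw [hxτ] at h1
    have h2 : (z 0 - lam * m) ^ 2 ≤ (z τ + lam * m) ^ 2 := by nlinarith
    have h3 : x t ^ 2 ≤ (B + 1) ^ 2 := pow_le_pow_left₀ (hxnn t ht) hxB 2
    nlinarith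
  have hFA : ∀ t ∈ Icc 0 τ, x t ≤ B + 1 → |lam * F (x t)| ≤ lam * A := by
    intro t ht hxB
    rw [abs_mul, abs_of_pos hlam]
    exact mul_le_mul_of_nonneg_left (hA _ ⟨hxnn t ht, hxB⟩) hlam.le
  have hup : ∀ t ∈ Icc 0 τ, x t ≤ B + 1 → 0 ≤ z t →
      lam * (m + k) * B ≤ z t - lam * F (x t) := by
    intro t ht hxB hz
    have h1 := (abs_le.1 (hFA t ht hxB)).2
    have h2 := abs_le_of_sq_le_sq' (hann t ht hxB) (by linarith)
    linarith [h2.2]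
  have hdown : ∀ t ∈ Icc 0 τ, x t ≤ B + 1 → z t ≤ 0 →
      lam * (m + k) * B ≤ -(z t - lam * F (x t)) := by
    intro t ht hxB hz
    have h1 := (abs_le.1 (hFA t ht hxB)).1
    have h2 := sq_le_sq.1 (hann t ht hxB)
    rw [abs_of_nonneg (by positivity)] at h2
    rcases le_abs.1 h2 with h3 | h3 <;> linarith
  obtain ⟨s, hs, hzs⟩ : ∃ s ∈ Icc 0 τ, z s = 0 :=
    intermediate_value_Icc' hτ.le (h.continuousOn_snd.mono fun t ht => ht.1) ⟨hzτ.le, hz0.le⟩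
  have hzpos : ∀ t ∈ Ioo 0 s, 0 ≤ z t := fun t ht => by
    have := h.snd_anti ht.1.le ht.2.le fun r hr =>
      hxnn r ⟨ht.1.le.trans hr.1.le, hr.2.le.trans hs.2⟩
    linarith
  have hzneg : ∀ t ∈ Ioo s τ, z t ≤ 0 := fun t ht => by
    have := h.snd_anti hs.1 ht.1.le fun r hr =>
      hxnn r ⟨hs.1.trans hr.1.le, hr.2.le.trans ht.2.le⟩
    linarith
  have hpow : ∀ t ∈ Icc 0 τ, ∀ w, (x t ≤ B + 1 → lam * (m + k) * B ≤ w) →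
      0 ≤ lam * (x t * (F (x t) - k)) + max 0 (B + 1 - x t) * w := by
    intro t ht w hw
    have hx0 := hxnn t ht
    rcases le_total B (x t) with hBx | hBx
    · have h1 : 0 ≤ lam * (x t * (F (x t) - k)) :=
        mul_nonneg hlam.le (mul_nonneg hx0 (by linarith [hF.k_le _ hBx]))
      rcases le_total (B + 1) (x t) with h2 | h2
      · rw [max_eq_left (by linarith)]; linarith
      · have := mul_nonneg (le_max_left 0 (B + 1 - x t)) (hlB.le.trans (hw h2))
        linarith
    · have h1 : lam * (m + k) * B ≤ max 0 (B + 1 - x t) * w := by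
        have h2 : 1 ≤ max 0 (B + 1 - x t) := le_max_of_le_right (by linarith)
        have h3 := hw (by linarith)
        nlinarith
      have h2 : -((m + k) * B) ≤ x t * (F (x t) - k) := by
        nlinarith [hF.neg_m_le _ hx0]
      nlinarith
  have hder : ∀ t, 0 ≤ t → HasDerivWithinAt
      (fun t => -((x t ^ 2 + z t ^ 2) / 2) + lam * k * z t)
      (lam * (x t * (F (x t) - k))) (Ici 0) t := fun t ht => by
    refine (((h.hasDerivWithinAt_energy ht).div_const 2).neg.add
      ((h t ht).2.const_mul (lam * k))).congr_deriv ?_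
    ring
  have hderU : ∀ t, 0 ≤ t → HasDerivWithinAt (fun t => -(max 0 (B + 1 - x t) ^ 2 / 2))
      (max 0 (B + 1 - x t) * (z t - lam * F (x t))) (Ici 0) t := fun t ht =>
    (hasDerivAt_neg_sq_max_div_two (B + 1) (x t)).comp_hasDerivWithinAt t (h t ht).1
  have h1 := le_of_hasDerivWithinAt_nonneg (fun t ht => (hder t ht).add (hderU t ht)) le_rfl hs.1
    fun t ht => by
      have ht' : t ∈ Icc 0 τ := ⟨ht.1.le, ht.2.le.trans hs.2⟩
      exact hpow t ht' _ fun hxB => hup t ht' hxB (hzpos t ht)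
  have h2 := le_of_hasDerivWithinAt_nonneg (fun t ht => (hder t ht).sub (hderU t ht)) hs.1 hs.2
    fun t ht => by
      have ht' : t ∈ Icc 0 τ := ⟨hs.1.trans ht.1.le, ht.2.le⟩
      have := hpow t ht' _ fun hxB => hdown t ht' hxB (hzneg t ht)
      linarith
  have hB1 : max 0 (B + 1 - 0) = B + 1 := by rw [sub_zero, max_eq_right (by linarith)]
  simp only [Pi.add_apply, Pi.sub_apply, hx0, hxτ, hzs, hB1] at h1 h2
  nlinarith [sq_nonneg (max 0 (B + 1 - x s)), mul_le_mul_of_nonneg_left hge hlk.le]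

end LienardSol

/-- The Liénard vector field, with the square root of the damping parameter as an additional
constant coordinate. -/
def lienardField (F : ℝ → ℝ) (s : ℝ × ℝ × ℝ) : ℝ × ℝ × ℝ :=
  (0, s.2.2 - s.1 ^ 2 * F s.2.1, -s.2.1)

lemma contDiff_lienardField {F : ℝ → ℝ} (hF : ContDiff ℝ 1 F) : ContDiff ℝ 1 (lienardField F) := by
  unfold lienardField
  fun_prop

lemma LienardSol.forwardSol {F : ℝ → ℝ} {lam : ℝ} {x z : ℝ → ℝ} (hlam : 0 ≤ lam)
    (h : LienardSol F lam x z) : ForwardSol (lienardField F) fun t => (√lam, x t, z t) := by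
  intro t ht
  have := (hasDerivWithinAt_const t (Ici 0) (√lam)).prodMk ((h t ht).1.prodMk (h t ht).2)
  simpa [lienardField, Real.sq_sqrt hlam] using this

lemma LienardSol.eq {F : ℝ → ℝ} {lam : ℝ} {x z x' z' : ℝ → ℝ} (hF : ContDiff ℝ 1 F)
    (hlam : 0 ≤ lam) (h : LienardSol F lam x z) (h' : LienardSol F lam x' z') (hx : x 0 = x' 0)
    (hz : z 0 = z' 0) {t : ℝ} (ht : 0 ≤ t) : x t = x' t ∧ z t = z' t := by
  have := ForwardSol.eq (contDiff_lienardField hF) (h.forwardSol hlam) (h'.forwardSol hlam)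
    (by simp [hx, hz]) ht
  simpa using this

lemma ForwardSol.lienardSol {F : ℝ → ℝ} {γ : ℝ → ℝ × ℝ × ℝ}
    (h : ForwardSol (lienardField F) γ) :
    LienardSol F ((γ 0).1 ^ 2) (fun t => (γ t).2.1) (fun t => (γ t).2.2) := by
  have h1 : ∀ t, 0 ≤ t → HasDerivWithinAt (fun t => (γ t).1) 0 (Ici 0) t := fun t ht =>
    (hasFDerivAt_fst (𝕜 := ℝ) (p := γ t)).comp_hasDerivWithinAt t (h t ht)
  have h2 : ∀ t, 0 ≤ t → HasDerivWithinAt (fun t => (γ t).2) (lienardField F (γ t)).2 (Ici 0) t :=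
    fun t ht => (hasFDerivAt_snd (𝕜 := ℝ) (p := γ t)).comp_hasDerivWithinAt t (h t ht)
  have hc : ∀ t, 0 ≤ t → (γ t).1 = (γ 0).1 := by
    intro t ht
    have h3 := le_of_hasDerivWithinAt_nonneg h1 le_rfl ht fun _ _ => le_rfl
    have h4 := le_of_hasDerivWithinAt_nonneg (u := fun t => -(γ t).1) (fun t ht => (h1 t ht).neg)
      le_rfl ht fun _ _ => by simp
    linarith
  intro t ht
  have h3 := (hasFDerivAt_fst (𝕜 := ℝ) (p := (γ t).2)).comp_hasDerivWithinAt t (h2 t ht)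
  have h4 := (hasFDerivAt_snd (𝕜 := ℝ) (p := (γ t).2)).comp_hasDerivWithinAt t (h2 t ht)
  rw [← hc t ht]
  exact ⟨h3, h4⟩

/-- A family of maps `Φ λ t` is the forward flow of the Liénard system at parameter `λ`. -/
structure IsLienardFlow (F : ℝ → ℝ) (Φ : ℝ → ℝ → ℝ × ℝ → ℝ × ℝ) : Prop where
  zero : ∀ lam s, Φ lam 0 s = s
  sol : ∀ lam s, 0 ≤ lam → LienardSol F lam (fun t => (Φ lam t s).1) fun t => (Φ lam t s).2
  continuous : Continuous fun w : ℝ × ℝ × ℝ × ℝ => Φ w.1 w.2.1 w.2.2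

lemma DragilevShape.exists_isLienardFlow {F : ℝ → ℝ} {b m k B : ℝ}
    (hF : DragilevShape F b m k B) : ∃ Φ, IsLienardFlow F Φ := by
  have hB := hF.B_pos
  have hm := hF.m_pos
  obtain ⟨φ, h0, hs, hc⟩ := exists_semiflow (contDiff_lienardField hF.contDiff)
    (N := fun s => s.1 ^ 2 + (s.2.1 ^ 2 + s.2.2 ^ 2))
    (N' := fun s => (2 * s.1) • ContinuousLinearMap.fst ℝ ℝ (ℝ × ℝ) +
      ((2 * s.2.1) • (ContinuousLinearMap.fst ℝ ℝ ℝ).comp (ContinuousLinearMap.snd ℝ ℝ (ℝ × ℝ)) +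
        (2 * s.2.2) • (ContinuousLinearMap.snd ℝ ℝ ℝ).comp
          (ContinuousLinearMap.snd ℝ ℝ (ℝ × ℝ))))
    (C := 2 * (B * m))
    (fun s => by
      have h1 : HasFDerivAt (fun s : ℝ × ℝ × ℝ => s.1) (ContinuousLinearMap.fst ℝ ℝ (ℝ × ℝ)) s :=
        hasFDerivAt_fst
      have h2 : HasFDerivAt (fun s : ℝ × ℝ × ℝ => s.2.1)
          ((ContinuousLinearMap.fst ℝ ℝ ℝ).comp (ContinuousLinearMap.snd ℝ ℝ (ℝ × ℝ))) s :=
        hasFDerivAt_fst.comp s hasFDerivAt_snd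
      have h3 : HasFDerivAt (fun s : ℝ × ℝ × ℝ => s.2.2)
          ((ContinuousLinearMap.snd ℝ ℝ ℝ).comp (ContinuousLinearMap.snd ℝ ℝ (ℝ × ℝ))) s :=
        hasFDerivAt_snd.comp s hasFDerivAt_snd
      exact ((h1.pow 2).add ((h2.pow 2).add (h3.pow 2))).congr_fderiv (by simp))
    (by positivity) (fun s => by positivity)
    (fun s => by
      have h1 := mul_le_mul_of_nonneg_left (hF.neg_mul_le s.2.1) (sq_nonneg s.1)
      have h2 : 0 ≤ B * m * (s.2.1 ^ 2 + s.2.2 ^ 2) := by positivity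
      simp [lienardField]
      nlinarith)
    (fun c => ⟨1 + c, fun s hs => by
      have h1 := sq_nonneg s.1
      have h2 := sq_nonneg s.2.1
      have h3 := sq_nonneg s.2.2
      have key : ∀ r : ℝ, r ^ 2 ≤ c → ‖r‖ ≤ 1 + c := fun r hr => by
        rw [Real.norm_eq_abs, abs_le]
        constructor <;> nlinarith [sq_nonneg (r - 1), sq_nonneg (r + 1)]
      refine norm_prod_le_iff.2 ⟨key _ (by linarith), norm_prod_le_iff.2
        ⟨key _ (by linarith), key _ (by linarith)⟩⟩⟩)
  refine ⟨fun lam t s => (φ t (√lam, s)).2, fun lam s => by simp [h0], fun lam s hlam => ?_, ?_⟩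
  · have := (hs (√lam, s)).lienardSol
    simpa [h0, Real.sq_sqrt hlam] using this
  · have : Continuous fun w : ℝ × ℝ × ℝ × ℝ => (w.2.1, (√w.1, w.2.2)) := by fun_prop
    exact continuous_snd.comp (hc.comp this)

/-- `τ (λ, p)` is the first positive time at which the solution starting at `(0, p)` returns to the
vertical axis. -/
structure IsReturnTime (Φ : ℝ → ℝ → ℝ × ℝ → ℝ × ℝ) (τ : ℝ × ℝ → ℝ) : Prop where
  pos : ∀ w : ℝ × ℝ, 0 < w.1 → 0 < w.2 → 0 < τ w
  fst_pos : ∀ w : ℝ × ℝ, 0 < w.1 → 0 < w.2 → ∀ t ∈ Ioo 0 (τ w), 0 < (Φ w.1 t (0, w.2)).1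
  fst_eq : ∀ w : ℝ × ℝ, 0 < w.1 → 0 < w.2 → (Φ w.1 (τ w) (0, w.2)).1 = 0
  snd_neg : ∀ w : ℝ × ℝ, 0 < w.1 → 0 < w.2 → (Φ w.1 (τ w) (0, w.2)).2 < 0

section ReturnTime

variable {F : ℝ → ℝ} {b m k B : ℝ} {Φ : ℝ → ℝ → ℝ × ℝ → ℝ × ℝ} {τ : ℝ × ℝ → ℝ}

lemma IsLienardFlow.exists_isReturnTime (hF : DragilevShape F b m k B) (hΦ : IsLienardFlow F Φ) :
    ∃ τ, IsReturnTime Φ τ := by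
  have : ∀ w : ℝ × ℝ, ∃ τ, 0 < w.1 → 0 < w.2 → 0 < τ ∧
      (∀ t ∈ Ioo 0 τ, 0 < (Φ w.1 t (0, w.2)).1) ∧ (Φ w.1 τ (0, w.2)).1 = 0 ∧
      (Φ w.1 τ (0, w.2)).2 < 0 := by
    intro w
    by_cases hw : 0 < w.1 ∧ 0 < w.2
    · obtain ⟨τ, h1, h2⟩ := (hΦ.sol w.1 (0, w.2) hw.1.le).exists_return hF hw.1.le
        (by simp [hΦ.zero]) (by simpa [hΦ.zero] using hw.2)
      exact ⟨τ, fun _ _ => ⟨h1, h2⟩⟩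
    · exact ⟨0, fun h1 h2 => absurd ⟨h1, h2⟩ hw⟩
  choose τ hτ using this
  exact ⟨τ, fun w h1 h2 => (hτ w h1 h2).1, fun w h1 h2 => (hτ w h1 h2).2.1,
    fun w h1 h2 => (hτ w h1 h2).2.2.1, fun w h1 h2 => (hτ w h1 h2).2.2.2⟩

lemma IsReturnTime.continuousAt (hF : DragilevShape F b m k B) (hΦ : IsLienardFlow F Φ)
    (hτ : IsReturnTime Φ τ) {w₀ : ℝ × ℝ} (hlam : 0 < w₀.1) (hp : 0 < w₀.2) :
    ContinuousAt τ w₀ := by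
  have hW : ∀ᶠ w : ℝ × ℝ in 𝓝 w₀, 0 < w.1 ∧ 0 < w.2 :=
    (continuousAt_fst.eventually_const_lt hlam).and (continuousAt_snd.eventually_const_lt hp)
  have hcΦ : Continuous fun q : (ℝ × ℝ) × ℝ => Φ q.1.1 q.2 (0, q.1.2) :=
    hΦ.continuous.comp (g := fun w : ℝ × ℝ × ℝ × ℝ => Φ w.1 w.2.1 w.2.2)
      (f := fun q : (ℝ × ℝ) × ℝ => (q.1.1, q.2, (0, q.1.2))) (by fun_prop)
  have hcg : Continuous fun q : (ℝ × ℝ) × ℝ => (Φ q.1.1 q.2 (0, q.1.2)).1 :=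
    continuous_fst.comp hcΦ
  have hcF := hF.continuous
  have hcg' : Continuous fun q : (ℝ × ℝ) × ℝ =>
      (Φ q.1.1 q.2 (0, q.1.2)).2 - q.1.1 * F (Φ q.1.1 q.2 (0, q.1.2)).1 :=
    (continuous_snd.comp hcΦ).sub (by fun_prop)
  have hτ0 := hτ.pos w₀ hlam hp
  refine tendsto_order.2 ⟨fun a ha => ?_, fun a ha => ?_⟩
  · have ha' : max a (τ w₀ / 2) < τ w₀ := max_lt ha (by linarith)
    have ha0 : 0 < max a (τ w₀ / 2) := by positivity
    have h1 : ∀ᶠ q : (ℝ × ℝ) × ℝ in 𝓝 (w₀, 0),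
        0 < (Φ q.1.1 q.2 (0, q.1.2)).2 - q.1.1 * F (Φ q.1.1 q.2 (0, q.1.2)).1 :=
      hcg'.continuousAt.eventually_const_lt (by simpa [hΦ.zero, hF.zero] using hp)
    rw [nhds_prod_eq] at h1
    obtain ⟨U, hU, V, hV, hUV⟩ := Filter.eventually_prod_iff.1 h1
    obtain ⟨η, hη, hVη⟩ := Metric.eventually_nhds_iff.1 hV
    have h2 : ∀ᶠ w : ℝ × ℝ in 𝓝 w₀, ∀ t ∈ Icc (η / 2) (max a (τ w₀ / 2)),
        0 < (Φ w.1 t (0, w.2)).1 := by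
      refine isCompact_Icc.eventually_forall_of_forall_eventually fun t ht => ?_
      exact hcg.continuousAt.eventually_const_lt
        (hτ.fst_pos w₀ hlam hp t ⟨by linarith [ht.1], ht.2.trans_lt ha'⟩)
    filter_upwards [hW, hU, h2] with w hw hUw h2w
    refine (le_max_left a (τ w₀ / 2)).trans_lt ?_
    by_contra! hle
    have hτw := hτ.pos w hw.1 hw.2
    have h3 := hτ.fst_eq w hw.1 hw.2
    rcases le_total (η / 2) (τ w) with h4 | h4
    · exact (h2w _ ⟨h4, hle⟩).ne' h3
    · have h5 := lt_of_hasDerivWithinAt_pos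
        (fun t ht => (hΦ.sol w.1 (0, w.2) hw.1.le t ht).1) le_rfl hτw fun t ht =>
          hUV hUw (hVη (by rw [Real.dist_eq, sub_zero, abs_of_pos ht.1]; linarith [ht.2]))
      rw [h3, hΦ.zero] at h5
      exact lt_irrefl _ h5
  · have h1 : ∀ᶠ t in 𝓝 (τ w₀),
        (Φ w₀.1 t (0, w₀.2)).2 - w₀.1 * F (Φ w₀.1 t (0, w₀.2)).1 < 0 := by
      have : Continuous fun t => (Φ w₀.1 t (0, w₀.2)).2 - w₀.1 * F (Φ w₀.1 t (0, w₀.2)).1 :=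
        hcg'.comp (Continuous.prodMk_right w₀)
      refine this.continuousAt.eventually_lt_const ?_
      simpa [hτ.fst_eq w₀ hlam hp, hF.zero] using hτ.snd_neg w₀ hlam hp
    obtain ⟨η, hη, hη'⟩ := Metric.eventually_nhds_iff.1 h1
    obtain ⟨t₁, ht₁, ht₁'⟩ := exists_between (lt_min ha (by linarith : τ w₀ < τ w₀ + η))
    have h2 := lt_of_hasDerivWithinAt_pos (u := fun t => -(Φ w₀.1 t (0, w₀.2)).1)
      (fun t ht => (hΦ.sol w₀.1 (0, w₀.2) hlam.le t ht).1.neg) hτ0.le ht₁ fun t ht => by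
        have h3 := ht₁'.trans_le (min_le_right _ _)
        have := hη' (y := t) (by rw [Real.dist_eq, abs_of_pos (by linarith [ht.1])]; linarith [ht.2])
        linarith
    rw [hτ.fst_eq w₀ hlam hp] at h2
    have h3 : ∀ᶠ w : ℝ × ℝ in 𝓝 w₀, (Φ w.1 t₁ (0, w.2)).1 < 0 :=
      (hcg.comp (Continuous.prodMk_left t₁)).continuousAt.eventually_lt_const
        (by simpa using h2)
    filter_upwards [hW, h3] with w hw h3w
    refine lt_of_le_of_lt ?_ (ht₁'.trans_le (min_le_left _ _))
    by_contra! hlt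
    exact absurd (hτ.fst_pos w hw.1 hw.2 t₁ ⟨hτ0.trans ht₁, hlt⟩) (not_lt.2 h3w.le)

end ReturnTime

/-- Beyond this height every crossing of a half plane loses energy. -/
noncomputable def excursionBound (m k B A lam : ℝ) : ℝ :=
  2 * (lam * m) + lam * (m + k) * B + lam * A + (B + 1) + (B + 1) ^ 2 / (2 * (lam * k)) + 1

/-- The distance to the origin at which the solution starting at `(0, p)` first returns to the
vertical axis. -/
def halfReturn (Φ : ℝ → ℝ → ℝ × ℝ → ℝ × ℝ) (τ : ℝ × ℝ → ℝ) (w : ℝ × ℝ) : ℝ :=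
  -(Φ w.1 (τ w) (0, w.2)).2

namespace IsReturnTime

variable {F : ℝ → ℝ} {b m k B : ℝ} {Φ : ℝ → ℝ → ℝ × ℝ → ℝ × ℝ} {τ : ℝ × ℝ → ℝ} {w : ℝ × ℝ}

lemma continuousAt_halfReturn (hF : DragilevShape F b m k B) (hΦ : IsLienardFlow F Φ)
    (hτ : IsReturnTime Φ τ) (hlam : 0 < w.1) (hp : 0 < w.2) :
    ContinuousAt (halfReturn Φ τ) w := by
  have h1 := hτ.continuousAt hF hΦ hlam hp
  have h2 : ContinuousAt (fun w : ℝ × ℝ => (w.1, τ w, ((0 : ℝ), w.2))) w := by fun_prop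
  exact (hΦ.continuous.continuousAt.comp
    (g := fun w : ℝ × ℝ × ℝ × ℝ => Φ w.1 w.2.1 w.2.2) h2).snd.neg

lemma halfReturn_pos (hτ : IsReturnTime Φ τ) (hlam : 0 < w.1) (hp : 0 < w.2) :
    0 < halfReturn Φ τ w := by
  have := hτ.snd_neg w hlam hp
  unfold halfReturn
  linarith

lemma apply_eq (hτ : IsReturnTime Φ τ) (hlam : 0 < w.1) (hp : 0 < w.2) :
    Φ w.1 (τ w) (0, w.2) = (0, -halfReturn Φ τ w) := by
  refine Prod.ext (hτ.fst_eq w hlam hp) ?_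
  simp [halfReturn]

lemma halfReturn_le (hF : DragilevShape F b m k B) (hΦ : IsLienardFlow F Φ)
    (hτ : IsReturnTime Φ τ) (hlam : 0 < w.1) (hp : 0 < w.2) :
    halfReturn Φ τ w ≤ w.2 + 2 * (w.1 * m) := by
  have := (hΦ.sol w.1 (0, w.2) hlam.le).return_le hF hlam.le (by simp [hΦ.zero])
    (by simpa [hΦ.zero] using hp) (hτ.pos w hlam hp) (hτ.fst_pos w hlam hp) (hτ.fst_eq w hlam hp)
  simpa [halfReturn, hΦ.zero] using this

lemma min_le_halfReturn (hF : DragilevShape F b m k B) (hΦ : IsLienardFlow F Φ)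
    (hτ : IsReturnTime Φ τ) (hlam : 0 < w.1) (hp : 0 < w.2) :
    min w.2 b ≤ halfReturn Φ τ w := by
  have := (hΦ.sol w.1 (0, w.2) hlam.le).min_le_return hF hlam.le (by simp [hΦ.zero])
    (by simpa [hΦ.zero] using hp) (hτ.pos w hlam hp) (hτ.fst_eq w hlam hp) (hτ.snd_neg w hlam hp)
  simpa [halfReturn, hΦ.zero] using this

lemma lt_halfReturn (hF : DragilevShape F b m k B) (hΦ : IsLienardFlow F Φ)
    (hτ : IsReturnTime Φ τ) (hlam : 0 < w.1) (hp : 0 < w.2) (hpb : w.2 < b) :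
    w.2 < halfReturn Φ τ w := by
  have := (hΦ.sol w.1 (0, w.2) hlam.le).lt_return hF hlam (by simp [hΦ.zero])
    (by simpa [hΦ.zero] using hp) (hτ.pos w hlam hp) (hτ.fst_pos w hlam hp)
    (hτ.fst_eq w hlam hp) (hτ.snd_neg w hlam hp) (by simpa [hΦ.zero] using hpb)
  simpa [halfReturn, hΦ.zero] using this

lemma halfReturn_lt (hF : DragilevShape F b m k B) (hΦ : IsLienardFlow F Φ)
    (hτ : IsReturnTime Φ τ) {A : ℝ} (hA0 : 0 ≤ A) (hA : ∀ y ∈ Icc 0 (B + 1), |F y| ≤ A)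
    (hlam : 0 < w.1) (hp : 0 < w.2) (hbig : excursionBound m k B A w.1 ≤ w.2) :
    halfReturn Φ τ w < w.2 := by
  have hm := hF.m_pos
  have hk := hF.k_pos
  have hB := hF.B_pos
  unfold excursionBound at hbig
  have h0 : 0 < 2 * (w.1 * k) := by positivity
  have h1 : 0 ≤ (B + 1) ^ 2 / (2 * (w.1 * k)) := by positivity
  have h2 : (B + 1) ^ 2 / (2 * (w.1 * k)) < w.2 := by
    have : 0 ≤ 2 * (w.1 * m) + w.1 * (m + k) * B + w.1 * A + (B + 1) := by positivity
    linarith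
  rw [div_lt_iff₀ h0] at h2
  have := (hΦ.sol w.1 (0, w.2) hlam.le).return_lt hF hlam (by simp [hΦ.zero]) hA0 hA
    (by simp only [hΦ.zero]; linarith) (by simp only [hΦ.zero]; linarith) (hτ.pos w hlam hp)
    (hτ.fst_pos w hlam hp) (hτ.fst_eq w hlam hp) (hτ.snd_neg w hlam hp)
  simpa [halfReturn, hΦ.zero] using this

end IsReturnTime

/-- `P` is a return map of the flow `Φ` to the positive vertical axis, with return time `T`; its
fixed points lie in `[b, M λ]`. -/
structure IsReturnMap (Φ : ℝ → ℝ → ℝ × ℝ → ℝ × ℝ) (P T : ℝ × ℝ → ℝ) (b : ℝ) (M : ℝ → ℝ) :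
    Prop where
  continuousAt : ∀ w : ℝ × ℝ, 0 < w.1 → 0 < w.2 → ContinuousAt P w
  continuousAt_time : ∀ w : ℝ × ℝ, 0 < w.1 → 0 < w.2 → ContinuousAt T w
  time_pos : ∀ w : ℝ × ℝ, 0 < w.1 → 0 < w.2 → 0 < T w
  apply_eq : ∀ w : ℝ × ℝ, 0 < w.1 → 0 < w.2 → Φ w.1 (T w) (0, w.2) = (0, P w)
  b_pos : 0 < b
  lt_apply : ∀ w : ℝ × ℝ, 0 < w.1 → 0 < w.2 → w.2 < b → w.2 < P w
  apply_lt : ∀ w : ℝ × ℝ, 0 < w.1 → 0 < w.2 → M w.1 < w.2 → P w < w.2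
  continuousOn_bound : ContinuousOn M (Ioi 0)

lemma DragilevShape.exists_isReturnMap {F : ℝ → ℝ} {b m k B : ℝ} (hF : DragilevShape F b m k B)
    {Φ : ℝ → ℝ → ℝ × ℝ → ℝ × ℝ} (hΦ : IsLienardFlow F Φ) :
    ∃ P T M, IsReturnMap Φ P T b M := by
  have hm := hF.m_pos
  have hk := hF.k_pos
  have hB := hF.B_pos
  obtain ⟨Φ', hΦ'⟩ := hF.reflect.exists_isLienardFlow
  obtain ⟨τ, hτ⟩ := hΦ.exists_isReturnTime hF
  obtain ⟨τ', hτ'⟩ := hΦ'.exists_isReturnTime hF.reflect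
  obtain ⟨A, hA⟩ : ∃ A, ∀ y ∈ Icc (-(B + 1)) (B + 1), |F y| ≤ A :=
    (isCompact_Icc.exists_bound_of_continuousOn hF.continuous.continuousOn)
  have hA0 : 0 ≤ A := (abs_nonneg _).trans (hA 0 ⟨by linarith, by linarith⟩)
  have hA1 : ∀ y ∈ Icc 0 (B + 1), |F y| ≤ A := fun y hy => hA y ⟨by linarith [hy.1], hy.2⟩
  have hA2 : ∀ y ∈ Icc 0 (B + 1), |-F (-y)| ≤ A := fun y hy => by
    rw [abs_neg]; exact hA _ ⟨by linarith [hy.2], by linarith [hy.1]⟩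
  set h := halfReturn Φ τ with hh
  set h' := halfReturn Φ' τ' with hh'
  have hpos : ∀ w : ℝ × ℝ, 0 < w.1 → 0 < w.2 → 0 < h w := fun w h1 h2 => hτ.halfReturn_pos h1 h2
  have hcont : ∀ w : ℝ × ℝ, 0 < w.1 → 0 < w.2 → ContinuousAt (fun w => (w.1, h w)) w :=
    fun w h1 h2 => continuousAt_fst.prodMk (hτ.continuousAt_halfReturn hF hΦ h1 h2)
  refine ⟨fun w => h' (w.1, h w), fun w => τ w + τ' (w.1, h w),
    fun lam => excursionBound m k B A lam + 2 * (lam * m), ?_⟩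
  constructor
  · intro w h1 h2
    exact ContinuousAt.comp (g := h') (f := fun w => (w.1, h w))
      (hτ'.continuousAt_halfReturn hF.reflect hΦ' h1 (hpos w h1 h2)) (hcont w h1 h2)
  · intro w h1 h2
    have e := ContinuousAt.comp (g := τ') (f := fun w => (w.1, h w))
      (hτ'.continuousAt (w₀ := (w.1, h w)) hF.reflect hΦ' h1 (hpos w h1 h2)) (hcont w h1 h2)
    exact (hτ.continuousAt hF hΦ h1 h2).add e
  · intro w h1 h2
    exact add_pos (hτ.pos w h1 h2) (hτ'.pos _ h1 (hpos w h1 h2))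
  · intro w h1 h2
    have e1 := (hΦ.sol w.1 (0, w.2) h1.le).shift (hτ.pos w h1 h2).le
    have e2 := (hΦ'.sol w.1 (0, h w) h1.le).reflect
    simp only [neg_neg] at e2
    have e3 := LienardSol.eq hF.contDiff h1.le e1 e2
      (by simp [hΦ'.zero, hτ.apply_eq h1 h2]) (by simp [hΦ'.zero, hτ.apply_eq h1 h2, hh])
      (hτ'.pos (w.1, h w) h1 (hpos w h1 h2)).le
    have e4 := hτ'.apply_eq (w := (w.1, h w)) h1 (hpos w h1 h2)
    simp only at e4
    rw [e4] at e3
    rw [add_comm]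
    exact Prod.ext (by simpa using e3.1) (by simpa using e3.2)
  · exact hF.b_pos
  · intro w h1 h2 h3
    have e1 := hτ.lt_halfReturn hF hΦ h1 h2 h3
    have e2 := hτ'.min_le_halfReturn (w := (w.1, h w)) hF.reflect hΦ' h1 (hpos w h1 h2)
    exact (lt_min e1 h3).trans_le e2
  · intro w h1 h2 h3
    have hlm : 0 < w.1 * m := by positivity
    rcases le_or_gt (excursionBound m k B A w.1) (h w) with hle | hlt
    · have e1 := hτ.halfReturn_lt hF hΦ hA0 hA1 h1 h2 (by linarith)
      have e2 := hτ'.halfReturn_lt (w := (w.1, h w)) hF.reflect hΦ' hA0 hA2 h1 (hpos w h1 h2) hle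
      exact e2.trans e1
    · have e2 := hτ'.halfReturn_le (w := (w.1, h w)) hF.reflect hΦ' h1 (hpos w h1 h2)
      simp only at e2
      linarith
  · unfold excursionBound
    have : ContinuousOn (fun lam : ℝ => (B + 1) ^ 2 / (2 * (lam * k))) (Ioi 0) :=
      continuousOn_const.div (by fun_prop) fun lam hlam => by
        have : 0 < lam := hlam
        positivity
    fun_prop

section PeriodicExtension

variable {α : Type*} {T : ℝ}

/-- The extension to the whole line of a function that is `T`-periodic on `[0, ∞)`. -/
noncomputable def periodicExtension (g : ℝ → α) (T t : ℝ) : α :=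
  g (t + ⌈|t| / T⌉₊ * T)

lemma apply_add_natCast_mul {g : ℝ → α} (hT : 0 < T) (hg : ∀ t, 0 ≤ t → g (t + T) = g t) {t : ℝ}
    (ht : 0 ≤ t) (n : ℕ) : g (t + n * T) = g t := by
  induction n with
  | zero => simp
  | succ n ih =>
    rw [← ih, ← hg (t + n * T) (by positivity)]
    push_cast
    ring_nf

lemma periodicExtension_eq {g : ℝ → α} (hT : 0 < T) (hg : ∀ t, 0 ≤ t → g (t + T) = g t) {t : ℝ}
    {n : ℕ} (hn : 0 ≤ t + n * T) : periodicExtension g T t = g (t + n * T) := by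
  have key : ∀ i j : ℕ, 0 ≤ t + i * T → i ≤ j → g (t + j * T) = g (t + i * T) := by
    intro i j hi hij
    obtain ⟨l, rfl⟩ := Nat.exists_eq_add_of_le hij
    rw [← apply_add_natCast_mul hT hg hi l]
    push_cast
    ring_nf
  have h0 : 0 ≤ t + ⌈|t| / T⌉₊ * T := by
    have := (div_le_iff₀ hT).1 (Nat.le_ceil (|t| / T))
    linarith [neg_abs_le t]
  rcases le_total n ⌈|t| / T⌉₊ with h | h
  · exact key _ _ hn h
  · exact (key _ _ h0 h).symm

lemma periodicExtension_of_nonneg {g : ℝ → α} (hT : 0 < T) (hg : ∀ t, 0 ≤ t → g (t + T) = g t)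
    {t : ℝ} (ht : 0 ≤ t) : periodicExtension g T t = g t := by
  simpa using periodicExtension_eq hT hg (t := t) (n := 0) (by simpa using ht)

lemma exists_lt_add_natCast_mul (hT : 0 < T) (t : ℝ) : ∃ n : ℕ, 0 < t + n * T := by
  obtain ⟨n, hn⟩ := exists_nat_gt (-t / T)
  exact ⟨n, by linarith [(div_lt_iff₀ hT).1 hn]⟩

lemma periodic_periodicExtension {g : ℝ → α} (hT : 0 < T)
    (hg : ∀ t, 0 ≤ t → g (t + T) = g t) : Function.Periodic (periodicExtension g T) T := by
  intro t
  obtain ⟨n, hn⟩ := exists_lt_add_natCast_mul hT t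
  rw [periodicExtension_eq hT hg hn.le, periodicExtension_eq hT hg (n := n) (by linarith),
    ← hg _ hn.le]
  ring_nf

lemma range_periodicExtension {g : ℝ → α} (hT : 0 < T) (hg : ∀ t, 0 ≤ t → g (t + T) = g t) :
    range (periodicExtension g T) = g '' Icc 0 T := by
  rw [← (periodic_periodicExtension hT hg).image_Icc hT 0, zero_add]
  exact image_congr fun t ht => periodicExtension_of_nonneg hT hg ht.1

lemma hasDerivAt_periodicExtension {g g' : ℝ → ℝ} (hT : 0 < T)
    (hg : ∀ t, 0 ≤ t → g (t + T) = g t) (hg' : ∀ t, 0 ≤ t → g' (t + T) = g' t)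
    (h : ∀ t, 0 ≤ t → HasDerivWithinAt g (g' t) (Ici 0) t) (t : ℝ) :
    HasDerivAt (periodicExtension g T) (periodicExtension g' T t) t := by
  obtain ⟨n, hn⟩ := exists_lt_add_natCast_mul hT t
  rw [periodicExtension_eq hT hg' hn.le]
  have h1 := ((h _ hn.le).hasDerivAt (Ici_mem_nhds hn)).comp_add_const t (n * T)
  refine h1.congr_of_eventuallyEq ?_
  have : ContinuousAt (fun s : ℝ => s + n * T) t := by fun_prop
  filter_upwards [this.eventually_const_lt hn] with s hs
  exact periodicExtension_eq hT hg hs.le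

end PeriodicExtension

lemma LienardSol.exists_isPeriodicSol {F f : ℝ → ℝ} {lam T : ℝ} {x z : ℝ → ℝ}
    (hF : ∀ x, HasDerivAt F (f x) x) (h : LienardSol F lam x z) (hT : 0 < T)
    (hx : ∀ t, 0 ≤ t → x (t + T) = x t) (hz : ∀ t, 0 ≤ t → z (t + T) = z t)
    (hne : z 0 - lam * F (x 0) ≠ 0) :
    ∃ x' y', IsPeriodicSol f lam x' y' ∧
      range (fun t => (x' t, y' t)) = (fun t => (x t, z t - lam * F (x t))) '' Icc 0 T := by
  set y : ℝ → ℝ := fun t => z t - lam * F (x t) with hy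
  have hyT : ∀ t, 0 ≤ t → y (t + T) = y t := fun t ht => by simp [hy, hx t ht, hz t ht]
  have hdy : ∀ t, 0 ≤ t → HasDerivWithinAt y (-(x t) - lam * f (x t) * y t) (Ici 0) t :=
    fun t ht => by
      refine ((h t ht).2.sub (((hF (x t)).comp_hasDerivWithinAt t (h t ht).1).const_mul
        lam)).congr_deriv ?_
      ring
  have hdx := hasDerivAt_periodicExtension hT hx hyT fun t ht => (h t ht).1
  have hdy := hasDerivAt_periodicExtension hT hyT
    (fun t ht => by rw [hx t ht, hyT t ht]) hdy
  refine ⟨periodicExtension x T, periodicExtension y T, ⟨⟨T, hT, fun t =>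
    ⟨periodic_periodicExtension hT hx t, periodic_periodicExtension hT hyT t⟩⟩, hdx, hdy, ?_⟩, ?_⟩
  · by_contra! hc
    have h1 : periodicExtension x T = fun _ => periodicExtension x T 0 :=
      funext fun t => (Prod.ext_iff.1 (hc t 0)).1
    have h2 := hdx 0
    rw [h1] at h2
    have h3 := h2.unique (hasDerivAt_const _ _)
    rw [periodicExtension_of_nonneg hT hyT le_rfl] at h3
    exact hne h3
  · exact range_periodicExtension (g := fun t => (x t, y t)) hT fun t ht => by
      rw [hx t ht, hyT t ht]

/-- Images of intervals under a continuous family of curves vary continuously. -/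
lemma eventually_hausdorffDist_image_Icc_lt {X E : Type*} [TopologicalSpace X]
    [PseudoMetricSpace E] {G : X → ℝ → E} {T : X → ℝ} {w₀ : X}
    (hG : Continuous (Function.uncurry G)) (hT : ContinuousAt T w₀)
    (hT0 : ∀ᶠ w in 𝓝 w₀, 0 ≤ T w) {ε : ℝ} (hε : 0 < ε) :
    ∀ᶠ w in 𝓝 w₀, hausdorffDist (G w '' Icc 0 (T w)) (G w₀ '' Icc 0 (T w₀)) < ε := by
  have h1 : ∀ᶠ w in 𝓝 w₀, ∀ s ∈ Icc (0 : ℝ) 1,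
      dist (G w (s * T w)) (G w₀ (s * T w₀)) < ε / 2 := by
    refine isCompact_Icc.eventually_forall_of_forall_eventually fun s hs => ?_
    have hc1 : ContinuousAt (fun q : X × ℝ => (q.1, q.2 * T q.1)) (w₀, s) :=
      continuousAt_fst.prodMk (continuousAt_snd.mul
        (ContinuousAt.comp (g := T) (f := Prod.fst) hT continuousAt_fst))
    have hc2 : ContinuousAt (fun q : X × ℝ => (w₀, q.2 * T w₀)) (w₀, s) := by fun_prop
    have hc := (hG.continuousAt.comp hc1).dist (hG.continuousAt.comp hc2)
    exact hc.eventually_lt_const (by simpa using half_pos hε)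
  have hpar : ∀ w, 0 ≤ T w → ∀ t ∈ Icc 0 (T w), ∃ s ∈ Icc (0 : ℝ) 1, s * T w = t := by
    intro w hw t ht
    rcases hw.eq_or_lt with h | h
    · exact ⟨0, by simp, by rw [zero_mul]; exact le_antisymm ht.1 (by linarith [ht.2])⟩
    · exact ⟨t / T w, ⟨div_nonneg ht.1 hw, (div_le_one h).2 ht.2⟩, div_mul_cancel₀ _ h.ne'⟩
  have hmem : ∀ w, 0 ≤ T w → ∀ s ∈ Icc (0 : ℝ) 1, s * T w ∈ Icc 0 (T w) := fun w hw s hs =>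
    ⟨mul_nonneg hs.1 hw, mul_le_of_le_one_left hw hs.2⟩
  have h0 := hT0.self_of_nhds
  filter_upwards [h1, hT0] with w hw hTw
  refine (hausdorffDist_le_of_mem_dist (half_pos hε).le ?_ ?_).trans_lt (half_lt_self hε)
  · rintro _ ⟨t, ht, rfl⟩
    obtain ⟨s, hs, rfl⟩ := hpar w hTw t ht
    exact ⟨_, ⟨_, hmem w₀ h0 s hs, rfl⟩, (hw s hs).le⟩
  · rintro _ ⟨t, ht, rfl⟩
    obtain ⟨s, hs, rfl⟩ := hpar w₀ h0 t ht
    exact ⟨_, ⟨_, hmem w hTw s hs, rfl⟩, by rw [dist_comm]; exact (hw s hs).le⟩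

section ReturnMap

variable {F f : ℝ → ℝ} {b : ℝ} {M : ℝ → ℝ} {Φ : ℝ → ℝ → ℝ × ℝ → ℝ × ℝ} {P T : ℝ × ℝ → ℝ}

/-- The trajectory starting at `(0, p)`, in the coordinates `(x, x')`. -/
def phaseCurve (F : ℝ → ℝ) (Φ : ℝ → ℝ → ℝ × ℝ → ℝ × ℝ) (w : ℝ × ℝ) (t : ℝ) : ℝ × ℝ :=
  ((Φ w.1 t (0, w.2)).1, (Φ w.1 t (0, w.2)).2 - w.1 * F (Φ w.1 t (0, w.2)).1)

lemma IsLienardFlow.continuous_phaseCurve (hF : Continuous F) (hΦ : IsLienardFlow F Φ) :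
    Continuous (Function.uncurry (phaseCurve F Φ)) := by
  have h : Continuous fun q : (ℝ × ℝ) × ℝ => Φ q.1.1 q.2 (0, q.1.2) :=
    hΦ.continuous.comp (g := fun w : ℝ × ℝ × ℝ × ℝ => Φ w.1 w.2.1 w.2.2)
      (f := fun q : (ℝ × ℝ) × ℝ => (q.1.1, q.2, (0, q.1.2))) (by fun_prop)
  exact h.fst.prodMk (h.snd.sub ((continuous_fst.fst).mul (hF.comp h.fst)))

lemma IsReturnMap.exists_fixedPoint (hR : IsReturnMap Φ P T b M) {lam : ℝ} (hlam : 0 < lam) :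
    ∃ p, 0 < p ∧ P (lam, p) = p := by
  have hb := hR.b_pos
  set c := max b (M lam) + 1 with hc
  have hbc : b / 2 ≤ c := by linarith [le_max_left b (M lam)]
  have hcont : ContinuousOn (fun p => P (lam, p) - p) (Icc (b / 2) c) := fun p hp => by
    have hp0 : 0 < p := by linarith [hp.1]
    exact ((ContinuousAt.comp (g := P) (f := fun p => (lam, p)) (hR.continuousAt (lam, p) hlam hp0)
      (by fun_prop)).sub continuousAt_id).continuousWithinAt
  have h1 := hR.lt_apply (lam, b / 2) hlam (half_pos hb) (half_lt_self hb)
  have h2 := hR.apply_lt (lam, c) hlam (by linarith : 0 < c)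
    (by linarith [le_max_right b (M lam)] : M lam < c)
  simp only at h1 h2
  obtain ⟨p, hp, hp'⟩ := intermediate_value_Icc' hbc hcont
    (show (0 : ℝ) ∈ Icc _ _ from ⟨by linarith, by linarith⟩)
  exact ⟨p, by linarith [hp.1], sub_eq_zero.1 hp'⟩

lemma IsReturnMap.mem_Icc (hR : IsReturnMap Φ P T b M) {lam p : ℝ} (hlam : 0 < lam) (hp : 0 < p)
    (hfix : P (lam, p) = p) : p ∈ Icc b (M lam) := by
  constructor <;> by_contra! h
  · exact (hR.lt_apply (lam, p) hlam hp h).ne' hfix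
  · exact (hR.apply_lt (lam, p) hlam hp h).ne hfix

lemma IsReturnMap.exists_isPeriodicSol (hF : ContDiff ℝ 1 F) (hFf : ∀ x, HasDerivAt F (f x) x)
    (hF0 : F 0 = 0) (hΦ : IsLienardFlow F Φ) (hR : IsReturnMap Φ P T b M) {lam p : ℝ}
    (hlam : 0 < lam) (hp : 0 < p) (hfix : P (lam, p) = p) :
    ∃ x y, IsPeriodicSol f lam x y ∧
      range (fun t => (x t, y t)) = phaseCurve F Φ (lam, p) '' Icc 0 (T (lam, p)) := by
  have hT := hR.time_pos (lam, p) hlam hp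
  have hsol := hΦ.sol lam (0, p) hlam.le
  have hper := hR.apply_eq (lam, p) hlam hp
  simp only [hfix] at hper
  have hshift := fun (t : ℝ) (ht : 0 ≤ t) => LienardSol.eq hF hlam.le (hsol.shift hT.le) hsol
    (by simp [hΦ.zero, hper]) (by simp [hΦ.zero, hper]) ht
  exact hsol.exists_isPeriodicSol hFf hT (fun t ht => (hshift t ht).1)
    (fun t ht => (hshift t ht).2) (by simpa [hΦ.zero, hF0] using hp.ne')

end ReturnMap

lemma IsPreconnected.pos_of_ne_zero {f : ℝ → ℝ} {S : Set ℝ} (hS : IsPreconnected S)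
    (hf : Continuous f) (hne : ∀ x ∈ S, f x ≠ 0) {a : ℝ} (ha : a ∈ S) (hfa : 0 < f a) :
    ∀ x ∈ S, 0 < f x := by
  intro x hx
  by_contra! hle
  obtain ⟨y, hy, hy0⟩ := hS.intermediate_value hx ha hf.continuousOn ⟨hle, hfa.le⟩
  exact hne y hy hy0

lemma exists_lt_pos_of_deriv_neg {f : ℝ → ℝ} {c : ℝ} (hd : deriv f c < 0) (hc : f c = 0) :
    ∃ x < c, 0 < f x := by
  have h := (eventually_nhdsWithin_sign_eq_of_deriv_neg hd hc).filter_mono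
    (nhdsWithin_le_nhds (s := Iio c))
  obtain ⟨x, hx, hxc⟩ := (h.and self_mem_nhdsWithin).exists
  exact ⟨x, hxc, sign_eq_one_iff.1 (hx.trans (sign_pos (sub_pos.2 hxc)))⟩

lemma exists_gt_neg_of_deriv_neg {f : ℝ → ℝ} {c e : ℝ} (hce : c < e) (hd : deriv f c < 0)
    (hc : f c = 0) : ∃ x ∈ Ioo c e, f x < 0 := by
  have h := (eventually_nhdsWithin_sign_eq_of_deriv_neg hd hc).filter_mono
    (nhdsWithin_le_nhds (s := Ioi c))
  obtain ⟨x, hx, hxc⟩ := (h.and (Ioo_mem_nhdsGT hce)).exists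
  exact ⟨x, hxc, sign_eq_neg_one_iff.1 (hx.trans (sign_neg (sub_neg.2 hxc.1)))⟩

lemma exists_gt_pos_of_deriv_pos {f : ℝ → ℝ} {c : ℝ} (hd : 0 < deriv f c) (hc : f c = 0) :
    ∃ x > c, 0 < f x := by
  have h := (eventually_nhdsWithin_sign_eq_of_deriv_pos hd hc).filter_mono
    (nhdsWithin_le_nhds (s := Ioi c))
  obtain ⟨x, hx, hxc⟩ := (h.and self_mem_nhdsWithin).exists
  exact ⟨x, hxc, sign_eq_one_iff.1 (hx.trans (sign_pos (sub_pos.2 hxc)))⟩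

/-- A primitive of a function with exactly two simple zeros around the origin is of Dragilev
type. -/
lemma dragilevShape_of_two_zeros {f F : ℝ → ℝ} {xM xm x₁ x₂ : ℝ} (hf : Continuous f)
    (hFf : ∀ x, HasDerivAt F (f x) x) (hF0 : F 0 = 0) (hxM : xM < 0) (hxm : 0 < xm)
    (hfxM : f xM = 0) (hfxm : f xm = 0) (hzeros : ∀ x, f x = 0 → x = xM ∨ x = xm)
    (hdM : deriv f xM < 0) (hdm : 0 < deriv f xm) (hx₁ : x₁ < xM) (hx₂ : xm < x₂)
    (hFx₁ : F x₁ = F xm) (hFx₂ : F x₂ = F xM) :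
    ∃ b m k B, DragilevShape F b m k B := by
  have hne : ∀ x, x ≠ xM → x ≠ xm → f x ≠ 0 := fun x h1 h2 h0 => (hzeros x h0).elim h1 h2
  have hleft : ∀ x ∈ Iio xM, 0 < f x := by
    obtain ⟨a, ha, hfa⟩ := exists_lt_pos_of_deriv_neg hdM hfxM
    exact isPreconnected_Iio.pos_of_ne_zero hf
      (fun x hx => hne x (ne_of_lt hx) ((mem_Iio.1 hx).trans (hxM.trans hxm)).ne) ha hfa
  have hmid : ∀ x ∈ Ioo xM xm, f x < 0 := by
    obtain ⟨a, ha, hfa⟩ := exists_gt_neg_of_deriv_neg (hxM.trans hxm) hdM hfxM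
    have := isPreconnected_Ioo.pos_of_ne_zero hf.neg
      (fun x hx => neg_ne_zero.2 (hne x hx.1.ne' hx.2.ne)) ha (neg_pos.2 hfa)
    exact fun x hx => neg_pos.1 (this x hx)
  have hright : ∀ x ∈ Ioi xm, 0 < f x := by
    obtain ⟨a, ha, hfa⟩ := exists_gt_pos_of_deriv_pos hdm hfxm
    exact isPreconnected_Ioi.pos_of_ne_zero hf
      (fun x hx => hne x ((hxM.trans hxm).trans hx).ne' (ne_of_gt hx)) ha hfa
  have hFc : Continuous F := continuous_iff_continuousAt.2 fun x => (hFf x).continuousAt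
  have hml : StrictMonoOn F (Iic xM) := strictMonoOn_of_deriv_pos (convex_Iic xM) hFc.continuousOn
    fun x hx => by rw [(hFf x).deriv]; exact hleft x (by simpa using hx)
  have hmm : StrictAntiOn F (Icc xM xm) := strictAntiOn_of_deriv_neg (convex_Icc xM xm)
    hFc.continuousOn fun x hx => by rw [(hFf x).deriv]; exact hmid x (by simpa using hx)
  have hmr : StrictMonoOn F (Ici xm) := strictMonoOn_of_deriv_pos (convex_Ici xm) hFc.continuousOn
    fun x hx => by rw [(hFf x).deriv]; exact hright x (by simpa using hx)
  have h0mem : (0 : ℝ) ∈ Icc xM xm := ⟨hxM.le, hxm.le⟩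
  have hMmem : xM ∈ Icc xM xm := ⟨le_rfl, (hxM.trans hxm).le⟩
  have hmmem : xm ∈ Icc xM xm := ⟨(hxM.trans hxm).le, le_rfl⟩
  have hFM : 0 < F xM := hF0 ▸ hmm hMmem h0mem hxM
  have hFm : F xm < 0 := hF0 ▸ hmm h0mem hmmem hxm
  refine ⟨min xm (-xM), max (F xM) (-F xm), min (F xM) (-F xm), max x₂ (-x₁), ?_⟩
  constructor
  · rw [contDiff_one_iff_deriv]
    exact ⟨fun x => (hFf x).differentiableAt, by rwa [funext fun x => (hFf x).deriv]⟩
  · exact hF0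
  · exact lt_min hxm (neg_pos.2 hxM)
  · exact lt_max_of_lt_left hFM
  · exact lt_min hFM (neg_pos.2 hFm)
  · exact lt_max_of_lt_left (hxm.trans hx₂)
  · intro x hx hx0
    have h1 := abs_le.1 (hx.trans (min_le_left _ _))
    have h2 := abs_le.1 (hx.trans (min_le_right _ _))
    have hmem : x ∈ Icc xM xm := ⟨by linarith, h1.2⟩
    rcases lt_or_gt_of_ne hx0 with h | h
    · exact mul_neg_of_neg_of_pos h (hF0 ▸ hmm hmem h0mem h)
    · exact mul_neg_of_pos_of_neg h (hF0 ▸ hmm h0mem hmem h)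
  · intro x hx
    have h1 : F xm ≤ F x := by
      rcases le_total x xm with h | h
      · exact hmm.antitoneOn ⟨hxM.le.trans hx, h⟩ hmmem h
      · exact hmr.monotoneOn self_mem_Ici h h
    linarith [le_max_right (F xM) (-F xm)]
  · intro x hx
    refine le_max_of_le_left ?_
    rcases le_total x xM with h | h
    · exact hml.monotoneOn h self_mem_Iic h
    · exact hmm.antitoneOn hMmem ⟨h, hx.trans hxm.le⟩ h
  · intro x hx
    have h : x₂ ≤ x := (le_max_left _ _).trans hx
    have := hmr.monotoneOn hx₂.le (hx₂.le.trans h) h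
    exact (min_le_left _ _).trans (hFx₂ ▸ this)
  · intro x hx
    have h : x ≤ x₁ := by linarith [le_max_right x₂ (-x₁)]
    have := hml.monotoneOn (h.trans hx₁.le) hx₁.le h
    linarith [min_le_right (F xM) (-F xm)]

lemma IsReturnMap.eventually_hausdorffDist_lt {F : ℝ → ℝ} {b : ℝ} {M : ℝ → ℝ}
    {Φ : ℝ → ℝ → ℝ × ℝ → ℝ × ℝ} {P T : ℝ × ℝ → ℝ} (hF : Continuous F) (hΦ : IsLienardFlow F Φ)
    (hR : IsReturnMap Φ P T b M) {lam₀ : ℝ} (hlam₀ : 0 < lam₀) {S : Set (ℝ × ℝ)}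
    (hS : ∀ p, 0 < p → P (lam₀, p) = p →
      phaseCurve F Φ (lam₀, p) '' Icc 0 (T (lam₀, p)) = S) {ε : ℝ} (hε : 0 < ε) :
    ∀ᶠ lam in 𝓝 lam₀, ∀ p, 0 < p → P (lam, p) = p →
      hausdorffDist (phaseCurve F Φ (lam, p) '' Icc 0 (T (lam, p))) S < ε := by
  have hb := hR.b_pos
  have hM : ∀ᶠ lam in 𝓝 lam₀, M lam < M lam₀ + 1 :=
    (hR.continuousOn_bound.continuousAt (Ioi_mem_nhds hlam₀)).eventually_lt_const (lt_add_one _)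
  have hK : ∀ᶠ lam in 𝓝 lam₀, ∀ p ∈ Icc b (M lam₀ + 1), P (lam, p) = p →
      hausdorffDist (phaseCurve F Φ (lam, p) '' Icc 0 (T (lam, p))) S < ε := by
    refine isCompact_Icc.eventually_forall_of_forall_eventually fun p hp => ?_
    have hp0 : 0 < p := hb.trans_le hp.1
    by_cases hfix : P (lam₀, p) = p
    · have hpos : ∀ᶠ w : ℝ × ℝ in 𝓝 (lam₀, p), 0 ≤ T w :=
        ((hR.continuousAt_time (lam₀, p) hlam₀ hp0).eventually_const_lt
          (hR.time_pos (lam₀, p) hlam₀ hp0)).mono fun _ => le_of_lt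
      filter_upwards [eventually_hausdorffDist_image_Icc_lt (hΦ.continuous_phaseCurve hF)
        (hR.continuousAt_time (lam₀, p) hlam₀ hp0) hpos hε] with w hw _
      rwa [hS p hp0 hfix] at hw
    · have hne : ∀ᶠ w : ℝ × ℝ in 𝓝 (lam₀, p), P w - w.2 ≠ 0 :=
        ((hR.continuousAt (lam₀, p) hlam₀ hp0).sub continuousAt_snd).eventually_ne
          (sub_ne_zero.2 hfix)
      filter_upwards [hne] with w hw hfixw
      exact absurd (sub_eq_zero.2 hfixw) hw
  filter_upwards [hM, hK, Ioi_mem_nhds hlam₀] with lam h1 h2 hlam p hp hfix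
  have hmem := hR.mem_Icc hlam hp hfix
  exact h2 p ⟨hmem.1, hmem.2.trans h1.le⟩ hfix

theorem limit_cycle_exists_unique_continuous (f : ℝ → ℝ) (xM xm : ℝ)
    (hf : ContDiff ℝ 2 f)
    (hxM : xM < 0) (hxm : 0 < xm)
    (hfxM : f xM = 0) (hfxm : f xm = 0)
    (hzeros : ∀ x, f x = 0 → x = xM ∨ x = xm)
    (hdM : deriv f xM < 0) (hdm : 0 < deriv f xm)
    (F : ℝ → ℝ) (hF : ∀ x, F x = ∫ s in (0:ℝ)..x, f s)
    (x₁ x₂ : ℝ) (hx₁ : x₁ < xM) (hx₂ : xm < x₂)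
    (hFx₁ : F x₁ = F xm) (hFx₂ : F x₂ = F xM)
    (hA3 : ∀ lam : ℝ, 0 < lam → ∀ x y x' y' : ℝ → ℝ,
      IsPeriodicSol f lam x y → IsPeriodicSol f lam x' y' →
      Set.range (fun t => (x t, y t)) = Set.range (fun t => (x' t, y' t))) :
    (∀ lam : ℝ, 0 < lam → ∃ x y : ℝ → ℝ, IsPeriodicSol f lam x y) ∧
    (∀ lam : ℝ, 0 < lam → ∀ x y x' y' : ℝ → ℝ,
      IsPeriodicSol f lam x y → IsPeriodicSol f lam x' y' →
      Set.range (fun t => (x t, y t)) = Set.range (fun t => (x' t, y' t))) ∧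
    (∀ lam₀ : ℝ, 0 < lam₀ → ∀ ε > (0:ℝ), ∃ δ > (0:ℝ),
      ∀ lam : ℝ, 0 < lam → |lam - lam₀| < δ →
        ∀ x y x₀ y₀ : ℝ → ℝ,
          IsPeriodicSol f lam x y → IsPeriodicSol f lam₀ x₀ y₀ →
          Metric.hausdorffDist (Set.range (fun t => (x t, y t)))
            (Set.range (fun t => (x₀ t, y₀ t))) < ε) := by
  have hFf : ∀ x, HasDerivAt F (f x) x := fun x => by
    rw [funext hF]
    exact (hf.continuous.integral_hasStrictDerivAt 0 x).hasDerivAt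
  have hF0 : F 0 = 0 := by simp [hF]
  obtain ⟨b, m, k, B, hshape⟩ := dragilevShape_of_two_zeros hf.continuous hFf hF0 hxM hxm hfxM hfxm
    hzeros hdM hdm hx₁ hx₂ hFx₁ hFx₂
  obtain ⟨Φ, hΦ⟩ := hshape.exists_isLienardFlow
  obtain ⟨P, T, M, hR⟩ := hshape.exists_isReturnMap hΦ
  have hsol := fun lam p => hR.exists_isPeriodicSol (lam := lam) (p := p) hshape.contDiff hFf hF0 hΦ
  refine ⟨fun lam hlam => ?_, hA3, fun lam₀ hlam₀ ε hε => ?_⟩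
  · obtain ⟨p, hp, hfix⟩ := hR.exists_fixedPoint hlam
    obtain ⟨x, y, hxy, -⟩ := hsol lam p hlam hp hfix
    exact ⟨x, y, hxy⟩
  · have himage : ∀ lam p, 0 < lam → 0 < p → P (lam, p) = p → ∀ x y, IsPeriodicSol f lam x y →
        phaseCurve F Φ (lam, p) '' Icc 0 (T (lam, p)) = range fun t => (x t, y t) := by
      intro lam p hlam hp hfix x y hxy
      obtain ⟨x', y', hxy', himg⟩ := hsol lam p hlam hp hfix
      rw [← himg]
      exact hA3 lam hlam x' y' x y hxy' hxy
    obtain ⟨p₀, hp₀, hfix₀⟩ := hR.exists_fixedPoint hlam₀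
    obtain ⟨x₀, y₀, hxy₀, -⟩ := hsol lam₀ p₀ hlam₀ hp₀ hfix₀
    obtain ⟨δ, hδ, hclose⟩ := Metric.eventually_nhds_iff.1
      (hR.eventually_hausdorffDist_lt hshape.continuous hΦ hlam₀
        (fun p hp hfix => himage lam₀ p hlam₀ hp hfix x₀ y₀ hxy₀) hε)
    refine ⟨δ, hδ, fun lam hlam hdist x y x₀' y₀' hxy hxy₀' => ?_⟩
    obtain ⟨p, hp, hfix⟩ := hR.exists_fixedPoint hlam
    have := hclose hdist p hp hfix
    rwa [himage lam p hlam hp hfix x y hxy, hA3 lam₀ hlam₀ x₀ y₀ x₀' y₀' hxy₀ hxy₀'] at this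
end

section
/- Assume hypotheses (A1), (A2) and (A3), and let ρ be the unique positive zero of F̄(r) = ∫_{−1}^{1} √(1 − s²) f(r s) ds. Then there exists x₀ > max{ρ, −x₁, x₂} with the following property: setting m = min{f(x) : −x₀ ≤ x ≤ x₀} (which satisfies m < 0) and defining γ(x; λ) = √((x + x₀)(x₀ − x − m λ (x + x₀))/(1 + m λ)) for 0 < λ ≤ −1/(2m) and γ(x; λ) = √((x + x₀)(x₀ − x + 8 m² λ² x₀)) for λ > −1/(2m), every nonconstant periodic solution t ↦ (x(t), y(t)) of (S1), for every λ > 0, satisfies −x₀ < x(t) < x₀ and −γ(−x(t); λ) < y(t) < γ(x(t); λ) for all t; that is, the periodic orbit is contained in the interior of the region R_λ = {(x, y) : −x₀ ≤ x ≤ x₀, −γ(−x; λ) ≤ y ≤ γ(x; λ)}. -/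
open Set

/-- A function whose derivative is nonpositive on `[p, q]` does not increase from `p` to `q`. -/
lemma apply_le_of_hasDerivAt_nonpos {g g' : ℝ → ℝ} {p q : ℝ} (hpq : p ≤ q)
    (hg : ∀ t, HasDerivAt g (g' t) t) (h : ∀ t ∈ Icc p q, g' t ≤ 0) : g q ≤ g p :=
  antitoneOn_of_hasDerivWithinAt_nonpos (convex_Icc p q)
    (fun t _ => (hg t).continuousAt.continuousWithinAt)
    (fun t _ => (hg t).hasDerivWithinAt) (fun t ht => h t (interior_subset ht))
    (left_mem_Icc.2 hpq) (right_mem_Icc.2 hpq) hpq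

lemma hasDerivAt_nonpos_of_le_right {g : ℝ → ℝ} {v u q : ℝ} (hg : HasDerivAt g v u) (huq : u < q)
    (h : ∀ r ∈ Ioo u q, g r ≤ g u) : v ≤ 0 := by
  have h1 : Filter.Tendsto (slope g u) (nhdsWithin u (Ioi u)) (nhds v) :=
    (hasDerivWithinAt_iff_tendsto_slope' self_notMem_Ioi).1 hg.hasDerivWithinAt
  refine le_of_tendsto h1 ?_
  filter_upwards [Ioo_mem_nhdsGT huq] with r hr
  rw [slope_def_field]
  exact div_nonpos_of_nonpos_of_nonneg (by linarith [h r hr]) (by linarith [hr.1])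

lemma hasDerivAt_nonneg_of_le_left {g : ℝ → ℝ} {v u q : ℝ} (hg : HasDerivAt g v u) (hqu : q < u)
    (h : ∀ r ∈ Ioo q u, g r ≤ g u) : 0 ≤ v := by
  have h1 : Filter.Tendsto (slope g u) (nhdsWithin u (Iio u)) (nhds v) :=
    (hasDerivWithinAt_iff_tendsto_slope' self_notMem_Iio).1 hg.hasDerivWithinAt
  refine ge_of_tendsto h1 ?_
  filter_upwards [Ioo_mem_nhdsLT hqu] with r hr
  rw [slope_def_field]
  exact div_nonneg_of_nonpos (by linarith [h r hr]) (by linarith [hr.2])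

/-- The last time before `q` at which `g` is at least `k`. -/
lemma exists_last_eq {g : ℝ → ℝ} (hg : Continuous g) {p q k : ℝ} (hpq : p ≤ q)
    (hp : k ≤ g p) (hq : g q < k) : ∃ u, p ≤ u ∧ u < q ∧ g u = k ∧ ∀ r ∈ Ioc u q, g r < k := by
  have hc : IsCompact (Icc p q ∩ g ⁻¹' Ici k) :=
    isCompact_Icc.inter_right (isClosed_Ici.preimage hg)
  obtain ⟨u, ⟨⟨hpu, huq⟩, hku⟩, hmax⟩ := hc.exists_isGreatest ⟨p, ⟨le_rfl, hpq⟩, hp⟩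
  have hku' : k ≤ g u := hku
  have hlt : ∀ r ∈ Ioc u q, g r < k := fun r hr => by
    by_contra! hr'
    exact absurd (hmax ⟨⟨hpu.trans hr.1.le, hr.2⟩, hr'⟩) (not_le.2 hr.1)
  have huq' : u < q := lt_of_le_of_ne huq (by rintro rfl; linarith)
  refine ⟨u, hpu, huq', le_antisymm ?_ hku', hlt⟩
  refine le_of_tendsto (hg.continuousAt.tendsto.mono_left nhdsWithin_le_nhds : Filter.Tendsto g
    (nhdsWithin u (Ioi u)) _) ?_
  filter_upwards [Ioc_mem_nhdsGT huq'] with r hr using (hlt r hr).le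

/-- The first time after `p` at which `g` is at least `k`. -/
lemma exists_first_eq {g : ℝ → ℝ} (hg : Continuous g) {p q k : ℝ} (hpq : p ≤ q)
    (hp : g p < k) (hq : k ≤ g q) : ∃ u, p < u ∧ u ≤ q ∧ g u = k ∧ ∀ r ∈ Ico p u, g r < k := by
  obtain ⟨u, h1, h2, h3, h4⟩ := exists_last_eq (g := fun t => g (-t)) (hg.comp continuous_neg)
    (p := -q) (q := -p) (k := k) (by linarith) (by simpa using hq) (by simpa using hp)
  refine ⟨-u, by linarith, by linarith, h3, fun r hr => ?_⟩
  simpa using h4 (-r) ⟨by linarith [hr.2], by linarith [hr.1]⟩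

/-- `F` is a primitive of `f` whose values inside `[x₁, x₂]` lie between `b` and `a`, while `F ≤ b`
to the left and `F ≥ a` to the right of that interval, where moreover `f` is nonnegative. -/
structure IsDampingStrip (f F : ℝ → ℝ) (a b x₁ x₂ : ℝ) : Prop where
  hasDerivAt : ∀ x, HasDerivAt F (f x) x
  neg : x₁ < 0
  pos : 0 < x₂
  lt : b < a
  le_b : ∀ x ≤ x₁, F x ≤ b
  b_le : ∀ x, x₁ ≤ x → b ≤ F x
  le_a : ∀ x ≤ x₂, F x ≤ a
  a_le : ∀ x, x₂ ≤ x → a ≤ F x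
  nonneg_left : ∀ x ≤ x₁, 0 ≤ f x
  nonneg_right : ∀ x, x₂ ≤ x → 0 ≤ f x

lemma IsDampingStrip.reflect {f F : ℝ → ℝ} {a b x₁ x₂ : ℝ} (h : IsDampingStrip f F a b x₁ x₂) :
    IsDampingStrip (fun x => f (-x)) (fun x => -F (-x)) (-b) (-a) (-x₂) (-x₁) where
  hasDerivAt x := by
    have := ((h.hasDerivAt (-x)).comp x (hasDerivAt_neg x)).neg
    exact this.congr_deriv (by simp)
  neg := by linarith [h.pos]
  pos := by linarith [h.neg]
  lt := by linarith [h.lt]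
  le_b x hx := by linarith [h.a_le (-x) (by linarith)]
  b_le x hx := by linarith [h.le_a (-x) (by linarith)]
  le_a x hx := by linarith [h.b_le (-x) (by linarith)]
  a_le x hx := by linarith [h.le_b (-x) (by linarith)]
  nonneg_left x hx := h.nonneg_right (-x) (by linarith)
  nonneg_right x hx := h.nonneg_left (-x) (by linarith)

lemma IsPeriodicSol.reflect {f : ℝ → ℝ} {lam : ℝ} {x y : ℝ → ℝ} (h : IsPeriodicSol f lam x y) :
    IsPeriodicSol (fun x => f (-x)) lam (fun t => -x t) (fun t => -y t) := by
  obtain ⟨⟨T, hT, hper⟩, hx, hy, t₁, t₂, hne⟩ := h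
  refine ⟨⟨T, hT, fun t => by simp [hper t]⟩, fun t => (hx t).neg, fun t => ?_, t₁, t₂, ?_⟩
  · exact (hy t).neg.congr_deriv (by simp only [neg_neg]; ring)
  · simpa [Prod.ext_iff] using hne

section Solution

variable {f F : ℝ → ℝ} {a b x₁ x₂ lam : ℝ} {x y : ℝ → ℝ}

lemma hasDerivAt_momentum (hF : ∀ x, HasDerivAt F (f x) x) (hx : ∀ t, HasDerivAt x (y t) t)
    (hy : ∀ t, HasDerivAt y (-(x t) - lam * f (x t) * y t) t) (c t : ℝ) :
    HasDerivAt (fun t => y t + lam * (F (x t) - c)) (-(x t)) t := by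
  exact ((hy t).add ((((hF (x t)).comp t (hx t)).sub_const c).const_mul lam)).congr_deriv (by ring)

lemma hasDerivAt_lyapunov (hF : ∀ x, HasDerivAt F (f x) x) (hx : ∀ t, HasDerivAt x (y t) t)
    (hy : ∀ t, HasDerivAt y (-(x t) - lam * f (x t) * y t) t) (c t : ℝ) :
    HasDerivAt (fun t => x t ^ 2 + (y t + lam * (F (x t) - c)) ^ 2)
      (2 * lam * (x t * (c - F (x t)))) t := by
  exact (((hx t).pow 2).add ((hasDerivAt_momentum hF hx hy c t).pow 2)).congr_deriv
    (by push_cast; ring)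

lemma hasDerivAt_energy (hx : ∀ t, HasDerivAt x (y t) t)
    (hy : ∀ t, HasDerivAt y (-(x t) - lam * f (x t) * y t) t) (t : ℝ) :
    HasDerivAt (fun t => x t ^ 2 + y t ^ 2) (-(2 * lam * (f (x t) * y t ^ 2))) t := by
  exact (((hx t).pow 2).add ((hy t).pow 2)).congr_deriv (by push_cast; ring)

/-- Estimates along an arc of an orbit in the left half plane that ends high on the `y`-axis. -/
lemma IsDampingStrip.left_arc (h : IsDampingStrip f F a b x₁ x₂) (hlam : 0 < lam)
    (hx : ∀ t, HasDerivAt x (y t) t)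
    (hy : ∀ t, HasDerivAt y (-(x t) - lam * f (x t) * y t) t)
    {s t : ℝ} (hst : s < t) (hxs : x s = 0) (hxt : x t = 0) (hneg : ∀ r ∈ Ioo s t, x r < 0)
    {M : ℝ} (hM : -(2 * x₁) < M) (hMt : y t + lam * (F 0 - a) = M) :
    y s + lam * (F 0 - b) ≤ -(M + x₁) ∧
      (y t + lam * (F 0 - (a + b) / 2)) ^ 2 < (y s + lam * (F 0 - (a + b) / 2)) ^ 2 := by
  have hx1 := h.neg
  have hx2 := h.pos
  have hab := h.lt
  have hcx : Continuous x := continuous_iff_continuousAt.2 fun t => (hx t).continuousAt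
  have hle : ∀ r ∈ Icc s t, x r ≤ 0 := fun r hr => by
    rcases eq_or_lt_of_le hr.1 with rfl | h1
    · exact hxs.le
    rcases eq_or_lt_of_le hr.2 with rfl | h2
    · exact hxt.le
    exact (hneg r ⟨h1, h2⟩).le
  obtain ⟨A, hA⟩ : ∃ A : ℝ → ℝ, A = fun t => y t + lam * (F (x t) - a) := ⟨_, rfl⟩
  obtain ⟨B, hB⟩ : ∃ B : ℝ → ℝ, B = fun t => y t + lam * (F (x t) - b) := ⟨_, rfl⟩
  obtain ⟨d, hd'⟩ : ∃ d : ℝ, d = lam * (a - b) := ⟨_, rfl⟩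
  have hdA : ∀ r, HasDerivAt A (-(x r)) r := fun r => by
    rw [hA]; exact hasDerivAt_momentum h.hasDerivAt hx hy a r
  have hdVa : ∀ r, HasDerivAt (fun t => x t ^ 2 + A t ^ 2) (2 * lam * (x r * (a - F (x r)))) r :=
    fun r => by rw [hA]; exact hasDerivAt_lyapunov h.hasDerivAt hx hy a r
  have hdVb : ∀ r, HasDerivAt (fun t => x t ^ 2 + B t ^ 2) (2 * lam * (x r * (b - F (x r)))) r :=
    fun r => by rw [hB]; exact hasDerivAt_lyapunov h.hasDerivAt hx hy b r
  have hBA : ∀ r, B r = A r + d := fun r => by rw [hA, hB, hd']; ring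
  have hd : 0 < d := hd' ▸ mul_pos hlam (by linarith)
  have hFx1 : F x₁ = b := le_antisymm (h.le_b _ le_rfl) (h.b_le _ le_rfl)
  have hAmono : ∀ p q, s ≤ p → p ≤ q → q ≤ t → A p ≤ A q := fun p q hp hpq hq => by
    have := apply_le_of_hasDerivAt_nonpos (g := fun r => -A r) hpq
      (fun r => (hdA r).neg)
      (fun r hr => by linarith [hle r ⟨hp.trans hr.1, hr.2.trans hq⟩])
    linarith
  have hVa : ∀ p q, s ≤ p → p ≤ q → q ≤ t → x q ^ 2 + A q ^ 2 ≤ x p ^ 2 + A p ^ 2 :=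
    fun p q hp hpq hq => apply_le_of_hasDerivAt_nonpos hpq hdVa fun r hr => by
        have h1 := hle r ⟨hp.trans hr.1, hr.2.trans hq⟩
        exact mul_nonpos_of_nonneg_of_nonpos (by linarith)
          (mul_nonpos_of_nonpos_of_nonneg h1 (by linarith [h.le_a (x r) (by linarith)]))
  have hAt : A t = M := by simp only [hA, hxt, hMt]
  have hAs : A s < 0 := by
    have h1 := hVa s t le_rfl hst.le le_rfl
    have h2 : A s < A t := by
      obtain ⟨r, hr⟩ := exists_between hst
      obtain ⟨ξ, hξ, hξ'⟩ := exists_hasDerivAt_eq_slope A (fun r => -(x r)) hst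
        (fun r _ => (hdA r).continuousAt.continuousWithinAt)
        (fun r _ => hdA r)
      have h3 : 0 < (A t - A s) / (t - s) := by rw [← hξ']; linarith [hneg ξ hξ]
      have := (div_pos_iff_of_pos_right (by linarith : 0 < t - s)).1 h3
      linarith
    rw [hxs, hxt, hAt] at h1
    by_contra! h3
    linarith [sq_lt_sq' (show -M < A s by linarith) (by linarith)]
  have hcA : Continuous A := continuous_iff_continuousAt.2 fun r =>
    (hdA r).continuousAt
  obtain ⟨τ, ⟨hsτ, hτt⟩, hAτ⟩ : (0 : ℝ) ∈ A '' Icc s t :=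
    intermediate_value_Icc hst.le hcA.continuousOn ⟨hAs.le, by linarith⟩
  have hxτ : x τ < x₁ := by
    have h1 := hVa τ t hsτ hτt le_rfl
    rw [hAτ, hAt, hxt] at h1
    by_contra! h2
    have h3 := hle τ ⟨hsτ, hτt⟩
    linarith [sq_lt_sq' (show -M < x τ by linarith) (by linarith)]
  obtain ⟨u, hsu, huτ, hxu, hu⟩ := exists_last_eq hcx hsτ (k := x₁) (by linarith) hxτ
  obtain ⟨v, hτv, hvt, hxv, hv⟩ := exists_first_eq hcx hτt (k := x₁) hxτ (by linarith)
  have hout : ∀ r ∈ Icc u v, x r ≤ x₁ := fun r hr => by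
    rcases eq_or_lt_of_le hr.1 with rfl | h1
    · exact hxu.le
    rcases eq_or_lt_of_le hr.2 with rfl | h2
    · exact hxv.le
    rcases le_total r τ with h3 | h3
    · exact (hu r ⟨h1, h3⟩).le
    · exact (hv r ⟨h3, h2⟩).le
  have huv : u ≤ v := (huτ.trans hτv).le
  have hAv : M + x₁ ≤ A v := by
    have h1 := hVa v t (hsτ.trans hτv.le) hvt le_rfl
    have h2 := hAmono τ v hsτ hτv.le hvt
    rw [hxv, hxt, hAt] at h1
    rw [hAτ] at h2
    by_contra! h3
    have h4 := sq_lt_sq' (show -(M + x₁) < A v by linarith) h3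
    have h5 : 0 ≤ -x₁ * (M + x₁) := mul_nonneg (by linarith) (by linarith)
    linarith
  have hBu' : B u = y u := by simp [hB, hxu, hFx1]
  have hBv' : B v = y v := by simp [hB, hxv, hFx1]
  have hyu : y u ≤ 0 := hasDerivAt_nonpos_of_le_right (hx u) huτ
    fun r hr => by rw [hxu]; exact (hu r ⟨hr.1, hr.2.le⟩).le
  have hBu : B u ≤ -(M + x₁) := by
    have h1 := apply_le_of_hasDerivAt_nonpos huv (hasDerivAt_energy hx hy) fun r hr => by
      have := mul_nonneg hlam.le (mul_nonneg (h.nonneg_left _ (hout r hr)) (sq_nonneg (y r)))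
      linarith
    rw [hxu, hxv] at h1
    have h2 := hBA v
    by_contra! h3
    have h4 := sq_lt_sq' (show -(M + x₁) < y u by linarith) (by linarith)
    have h5 := pow_le_pow_left₀ (by linarith) (show M + x₁ ≤ y v by linarith) 2
    linarith
  have hin : ∀ r ∈ Icc s u, x₁ ≤ x r := fun r hr => by
    by_contra! h1
    obtain ⟨w, hrw, hwu, hxw, hw⟩ := exists_first_eq hcx hr.2 h1 hxu.ge
    have h2 : 0 ≤ y w := hasDerivAt_nonneg_of_le_left (hx w) hrw
      fun z hz => by rw [hxw]; exact (hw z ⟨hz.1.le, hz.2⟩).le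
    have h3 := hAmono w u (hr.1.trans hrw.le) hwu (by linarith)
    have h4 : B w = y w := by simp [hB, hxw, hFx1]
    linarith [hBA w, hBA u]
  have hBsu := hAmono s u le_rfl hsu (by linarith)
  have hBs : B u + x₁ ≤ B s := by
    have h1 := apply_le_of_hasDerivAt_nonpos (g := fun r => -(x r ^ 2 + B r ^ 2)) hsu
      (fun r => (hdVb r).neg) fun r hr => by
        have h1 := hle r ⟨hr.1, by linarith [hr.2]⟩
        have := mul_nonneg hlam.le
          (mul_nonneg_of_nonpos_of_nonpos h1 (by linarith [h.b_le (x r) (hin r hr)] :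
            b - F (x r) ≤ 0))
        linarith
    simp only [hxs, hxu] at h1
    by_contra! h2
    have h3 := sq_lt_sq' (show -(-B s) < B u + x₁ by linarith) (by linarith)
    have h4 : 0 ≤ -B u * -x₁ := mul_nonneg (by linarith) (by linarith)
    linarith
  have hVb : B v ^ 2 ≤ B u ^ 2 := by
    have h1 := apply_le_of_hasDerivAt_nonpos huv hdVb fun r hr => by
        have h1 := hout r hr
        exact mul_nonpos_of_nonneg_of_nonpos (by linarith)
          (mul_nonpos_of_nonpos_of_nonneg (by linarith) (by linarith [h.le_b (x r) h1]))
    rw [hxu, hxv] at h1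
    linarith
  have hVsu := hVa s u le_rfl hsu (by linarith)
  have hVvt := hVa v t (by linarith) hvt le_rfl
  rw [hxs, hxu] at hVsu
  rw [hxv, hxt, hAt] at hVvt
  have hAs' : y s + lam * (F 0 - a) = A s := by simp only [hA, hxs]
  have hBs' : y s + lam * (F 0 - b) = B s := by simp only [hB, hxs]
  refine ⟨by rw [hBs']; linarith [hBA s, hBA u], ?_⟩
  have e1 : y t + lam * (F 0 - (a + b) / 2) = M + d / 2 := by rw [← hMt, hd']; ring
  have e2 : y s + lam * (F 0 - (a + b) / 2) = A s + d / 2 := by rw [← hAs', hd']; ring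
  rw [e1, e2]
  rw [hBA u, hBA v] at hVb
  rw [hBA u] at hBu
  rw [hBA u, hBA s] at hBs
  have key : 0 < d * (A s - 2 * A u + 2 * A v - M) := mul_pos hd (by linarith)
  linarith

end Solution

section Periodic

variable {f F : ℝ → ℝ} {a b x₁ x₂ lam : ℝ} {x y : ℝ → ℝ}

lemma exists_isMax_of_periodic {g : ℝ → ℝ} {T : ℝ} (hg : Continuous g) (hT : 0 < T)
    (hper : ∀ t, g (t + T) = g t) : ∃ t, ∀ r, g r ≤ g t := by
  obtain ⟨t, -, ht⟩ := isCompact_Icc.exists_isMaxOn (nonempty_Icc.2 hT.le) hg.continuousOn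
  refine ⟨t, fun r => ?_⟩
  obtain ⟨r', hr', h⟩ := Function.Periodic.exists_mem_Ico₀ (f := g) hper hT r
  rw [h]
  exact ht (Ico_subset_Icc_self hr')

lemma exists_arc_start {v t T : ℝ} (hcx : Continuous x) (hx : HasDerivAt x v t) (hv : 0 < v)
    (hxt : x t = 0) (hT : 0 < T) (hper : x (t - T) = 0) :
    ∃ s < t, x s = 0 ∧ ∀ r ∈ Ioo s t, x r < 0 := by
  have h1 : Filter.Tendsto (slope x t) (nhdsWithin t (Iio t)) (nhds v) :=
    (hasDerivWithinAt_iff_tendsto_slope' self_notMem_Iio).1 hx.hasDerivWithinAt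
  obtain ⟨l, hl, hlt⟩ := mem_nhdsLT_iff_exists_Ioo_subset.1 (h1.eventually (lt_mem_nhds hv))
  have hl' : ∀ r ∈ Ioo l t, x r < 0 := fun r hr => by
    have h2 : 0 < slope x t r := hlt hr
    rw [slope_def_field, hxt, sub_zero] at h2
    by_contra! h3
    exact absurd h2 (not_lt.2 (div_nonpos_of_nonneg_of_nonpos h3 (by linarith [hr.2])))
  obtain ⟨q, hq, hqt⟩ := exists_between (max_lt (mem_Iio.1 hl) (sub_lt_self t hT))
  rw [max_lt_iff] at hq
  obtain ⟨s, -, hsq, hxs, hs⟩ := exists_last_eq hcx hq.2.le hper.ge (hl' q ⟨hq.1, hqt⟩)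
  refine ⟨s, hsq.trans hqt, hxs, fun r hr => ?_⟩
  rcases le_total r q with h | h
  · exact hs r ⟨hr.1, h⟩
  · exact hl' r ⟨hq.1.trans_le h, hr.2⟩

/-- Periodic orbits stay below a curve `y + λ F(x) = const`, at a height independent of `λ`. -/
lemma IsDampingStrip.momentum_le (h : IsDampingStrip f F a b x₁ x₂) (hlam : 0 < lam)
    (hsol : IsPeriodicSol f lam x y) (t : ℝ) :
    y t + lam * (F (x t) - a) ≤ 2 * (x₂ - x₁) := by
  obtain ⟨⟨T, hT, hper⟩, hx, hy, -⟩ := id hsol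
  obtain ⟨-, hx', hy', -⟩ := hsol.reflect
  have hx1 := h.neg
  have hx2 := h.pos
  have hcx : Continuous x := continuous_iff_continuousAt.2 fun t => (hx t).continuousAt
  have hdA := hasDerivAt_momentum h.hasDerivAt hx hy a
  obtain ⟨t₂, ht₂⟩ := exists_isMax_of_periodic (g := fun t => y t + lam * (F (x t) - a))
    (continuous_iff_continuousAt.2 fun r => (hdA r).continuousAt) hT fun t => by simp [hper t]
  refine (ht₂ t).trans ?_
  by_contra! hM
  have hback : ∀ r, x r = 0 → x (r - T) = 0 := fun r hr => by
    have := (hper (r - T)).1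
    rw [sub_add_cancel] at this
    rw [← this, hr]
  have hxt : x t₂ = 0 := by
    have := (show IsLocalMax (fun t => y t + lam * (F (x t) - a)) t₂ from
      Filter.Eventually.of_forall ht₂).hasDerivAt_eq_zero (hdA t₂)
    linarith
  have hM2 := ht₂
  simp only [hxt] at hM hM2
  have hFa := mul_nonneg hlam.le (sub_nonneg.2 (h.le_a 0 hx2.le))
  have hFb := mul_nonneg hlam.le (sub_nonneg.2 (h.b_le 0 hx1.le))
  obtain ⟨s, hst, hxs, hs⟩ := exists_arc_start hcx (hx t₂) (by linarith) hxt hT (hback _ hxt)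
  obtain ⟨h1, h2⟩ := h.left_arc hlam hx hy hst hxs hxt hs (by linarith) rfl
  obtain ⟨p, hps, hxp, hp⟩ := exists_arc_start hcx.neg (hx s).neg (by linarith)
    (by simp [hxs]) hT (by simp [hback s hxs])
  obtain ⟨h3, h4⟩ := h.reflect.left_arc hlam hx' hy' hps hxp (by simp [hxs]) hp
    (M := -(y s + lam * (F 0 - b))) (by linarith) (by simp only [neg_zero]; ring)
  have hxp' : x p = 0 := by simpa using hxp
  have h5 := hM2 p
  simp only [hxp'] at h5
  simp only [neg_zero] at h3 h4
  have hd : 0 < lam * (a - b) := mul_pos hlam (by linarith [h.lt])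
  have h6 : (y t₂ + lam * (F 0 - (a + b) / 2)) ^ 2 < (y p + lam * (F 0 - (a + b) / 2)) ^ 2 := by
    refine h2.trans ?_
    linarith
  have h7 := pow_le_pow_left₀ (show 0 ≤ y p + lam * (F 0 - (a + b) / 2) by linarith)
    (show y p + lam * (F 0 - (a + b) / 2) ≤ y t₂ + lam * (F 0 - (a + b) / 2) by linarith) 2
  linarith

lemma IsDampingStrip.le_amplitude (h : IsDampingStrip f F a b x₁ x₂) (hlam : 0 < lam)
    (hsol : IsPeriodicSol f lam x y) (t : ℝ) : x t ≤ 2 * (x₂ - x₁) + x₂ := by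
  obtain ⟨⟨T, hT, hper⟩, hx, hy, -⟩ := id hsol
  have hx1 := h.neg
  have hx2 := h.pos
  have hcx : Continuous x := continuous_iff_continuousAt.2 fun t => (hx t).continuousAt
  obtain ⟨q, hq⟩ := exists_isMax_of_periodic hcx hT fun t => (hper t).1
  refine (hq t).trans ?_
  by_contra! hX
  have hyq : y q = 0 := (show IsLocalMax x q from
    Filter.Eventually.of_forall hq).hasDerivAt_eq_zero (hx q)
  obtain ⟨p, hpq, hp⟩ : ∃ p ≤ q, x p ≤ x₂ := by
    by_contra! hc
    have h1 := apply_le_of_hasDerivAt_nonpos (sub_le_self q hT.le)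
      (fun r => (hasDerivAt_momentum h.hasDerivAt hx hy a r).add ((hasDerivAt_id r).const_mul x₂))
      fun r hr => by linarith [hc r hr.2]
    have h2 := hper (q - T)
    rw [sub_add_cancel] at h2
    simp only [Pi.add_apply, h2.1, h2.2, id] at h1
    linarith [mul_pos hx2 hT]
  obtain ⟨v, -, hvq, hxv, hv⟩ := exists_last_eq (g := fun t => -x t) hcx.neg hpq (k := -x₂) (by linarith)
    (by linarith)
  have hxv' : x v = x₂ := by linarith
  have hyv : 0 ≤ y v := by
    have := hasDerivAt_nonpos_of_le_right (hx v).neg hvq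
      fun r hr => by simp only [Pi.neg_apply, hxv']; exact (hv r ⟨hr.1, hr.2.le⟩).le
    linarith
  have hyv' := h.momentum_le hlam hsol v
  rw [hxv', le_antisymm (h.le_a _ le_rfl) (h.a_le _ le_rfl), sub_self, mul_zero, add_zero] at hyv'
  have hE := apply_le_of_hasDerivAt_nonpos hvq.le (hasDerivAt_energy hx hy) fun r hr => by
    have hxr : x₂ ≤ x r := by
      rcases eq_or_lt_of_le hr.1 with rfl | h1
      · exact hxv'.ge
      · linarith [hv r ⟨h1, hr.2⟩]
    have := mul_nonneg hlam.le (mul_nonneg (h.nonneg_right _ hxr) (sq_nonneg (y r)))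
    linarith
  rw [hxv', hyq] at hE
  nlinarith

/-- An arc of an orbit in the upper half plane stays below a circular barrier. -/
lemma IsPeriodicSol.sq_lt_barrier (hsol : IsPeriodicSol f lam x y) (hlam : 0 < lam)
    {x₀ m G α κ : ℝ} (hxb : ∀ t, -x₀ < x t ∧ x t < x₀) (hm : ∀ u, -x₀ ≤ u → u ≤ x₀ → m ≤ f u)
    (hm0 : m < 0) (hG : 0 < G) (hκ : κ = -m * lam * G)
    (hpos : ∀ u, -x₀ < u → u < x₀ → 0 < α + 2 * κ * u - u ^ 2)
    (hle : ∀ u, -x₀ < u → u < x₀ → α + 2 * κ * u - u ^ 2 ≤ G ^ 2)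
    {t : ℝ} (ht : 0 < y t) : y t ^ 2 < α + 2 * κ * x t - x t ^ 2 := by
  obtain ⟨⟨T, hT, hper⟩, hx, hy, -⟩ := id hsol
  have hcy : Continuous y := continuous_iff_continuousAt.2 fun t => (hy t).continuousAt
  obtain ⟨p, hp, hyp⟩ : ∃ p ∈ Ioo (t - T) t, y p = 0 := by
    obtain ⟨p, hp, h⟩ := exists_hasDerivAt_eq_slope x y (sub_lt_self t hT)
      (fun r _ => (hx r).continuousAt.continuousWithinAt) fun r _ => hx r
    have h2 := hper (t - T)
    rw [sub_add_cancel] at h2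
    exact ⟨p, hp, by rw [h, h2.1, sub_self, zero_div]⟩
  obtain ⟨s, -, hst, hys, hs⟩ := exists_last_eq (g := fun t => -y t) hcy.neg hp.2.le (k := 0) (by simp [hyp])
    (by linarith)
  have hys' : y s = 0 := by simpa using hys
  have hy0 : ∀ r ∈ Icc s t, 0 ≤ y r := fun r hr => by
    rcases eq_or_lt_of_le hr.1 with rfl | h1
    · exact hys'.ge
    · linarith [hs r ⟨h1, hr.2⟩]
  have hD : ∀ r, HasDerivAt (fun r => y r ^ 2 - (2 * κ * x r - x r ^ 2))
      (-(2 * (y r * (κ + lam * f (x r) * y r)))) r := fun r =>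
    (((hy r).pow 2).sub (((hx r).const_mul (2 * κ)).sub ((hx r).pow 2))).congr_deriv
      (by push_cast; ring)
  have hmono : ∀ r, s ≤ r → r ≤ t → (∀ z ∈ Icc s r, y z ≤ G) →
      y r ^ 2 < α + 2 * κ * x r - x r ^ 2 := fun r hsr hrt hyG => by
    have h1 := apply_le_of_hasDerivAt_nonpos hsr hD fun z hz => by
      have hyz := hy0 z ⟨hz.1, hz.2.trans hrt⟩
      have h2 := mul_nonneg (mul_nonneg hlam.le hyz)
        (sub_nonneg.2 (hm (x z) (hxb z).1.le (hxb z).2.le))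
      have h3 := mul_nonneg (mul_nonneg hlam.le (neg_nonneg.2 hm0.le)) (sub_nonneg.2 (hyG z hz))
      have h4 := mul_nonneg hyz (show 0 ≤ κ + lam * f (x z) * y z by rw [hκ]; linarith)
      linarith
    have h2 := hpos (x s) (hxb s).1 (hxb s).2
    rw [hys'] at h1
    linarith
  have hG' : ∀ r ∈ Icc s t, y r < G := fun r hr => by
    by_contra! hc
    obtain ⟨w, hsw, hwr, hyw, hw⟩ := exists_first_eq hcy hr.1 (by rwa [hys']) hc
    have h1 := hmono w hsw.le (hwr.trans hr.2) fun z hz => by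
      rcases eq_or_lt_of_le hz.2 with rfl | h2
      · exact hyw.le
      · exact (hw z ⟨hz.1, h2⟩).le
    rw [hyw] at h1
    linarith [hle (x w) (hxb w).1 (hxb w).2]
  exact hmono t hst.le le_rfl fun z hz => (hG' z hz).le

lemma IsPeriodicSol.lt_sqrt_barrier (hsol : IsPeriodicSol f lam x y) (hlam : 0 < lam)
    {x₀ m : ℝ} (hx₀ : 0 < x₀) (hxb : ∀ t, -x₀ < x t ∧ x t < x₀)
    (hm : ∀ u, -x₀ ≤ u → u ≤ x₀ → m ≤ f u) (hm0 : m < 0) (t : ℝ) :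
    y t < if lam ≤ -1 / (2 * m) then
        Real.sqrt ((x t + x₀) * (x₀ - x t - m * lam * (x t + x₀)) / (1 + m * lam))
      else Real.sqrt ((x t + x₀) * (x₀ - x t + 8 * m ^ 2 * lam ^ 2 * x₀)) := by
  have hsqrt : ∀ G α κ : ℝ, 0 < G → κ = -m * lam * G →
      (∀ u, -x₀ < u → u < x₀ → 0 < α + 2 * κ * u - u ^ 2) →
      (∀ u, -x₀ < u → u < x₀ → α + 2 * κ * u - u ^ 2 ≤ G ^ 2) →
      y t < Real.sqrt (α + 2 * κ * x t - x t ^ 2) := fun G α κ hG hκ hpos hle => by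
    rcases le_or_gt (y t) 0 with h | h
    · exact h.trans_lt (Real.sqrt_pos.2 (hpos _ (hxb t).1 (hxb t).2))
    · exact (Real.lt_sqrt h.le).2 (hsol.sq_lt_barrier hlam hxb hm hm0 hG hκ hpos hle h)
  have hiff : lam ≤ -1 / (2 * m) ↔ -1 / 2 ≤ m * lam := by
    rw [le_div_iff_of_neg (by linarith)]
    constructor <;> intro h <;> linarith
  split_ifs with hl
  · rw [hiff] at hl
    have hml : m * lam < 0 := mul_neg_of_neg_of_pos hm0 hlam
    obtain ⟨k, hk⟩ : ∃ k, k = 1 / (1 + m * lam) := ⟨_, rfl⟩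
    have hne : 1 + m * lam ≠ 0 := by linarith
    have hk1 : k * (1 + m * lam) = 1 := by rw [hk]; field_simp
    have hk2 : 1 ≤ k := by
      rw [hk, le_div_iff₀ (by linarith)]; linarith
    have e : ∀ u, (u + x₀) * (x₀ - u - m * lam * (u + x₀)) / (1 + m * lam)
        = (2 * k * x₀ ^ 2 - x₀ ^ 2) + 2 * ((k - 1) * x₀) * u - u ^ 2 := fun u => by
      rw [hk]; field_simp; ring
    rw [e]
    refine hsqrt (k * x₀) _ _ (by positivity) (by linear_combination x₀ * hk1)
      (fun u h1 h2 => ?_) (fun u h1 h2 => ?_)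
    · have h3 : 0 < (u + x₀) * (x₀ - u) := mul_pos (by linarith) (by linarith)
      have h4 : 0 ≤ (k - 1) * (x₀ * (u + x₀)) :=
        mul_nonneg (by linarith) (mul_nonneg hx₀.le (by linarith))
      linarith
    · linarith [sq_nonneg (k * x₀ - (u + x₀))]
  · rw [hiff, not_le] at hl
    obtain ⟨n, hn⟩ : ∃ n, n = -(m * lam) := ⟨_, rfl⟩
    have hn2 : 1 / 2 < n := by linarith
    have e : ∀ u, (u + x₀) * (x₀ - u + 8 * m ^ 2 * lam ^ 2 * x₀)
        = (x₀ ^ 2 + 8 * n ^ 2 * x₀ ^ 2) + 2 * (4 * n ^ 2 * x₀) * u - u ^ 2 := fun u => by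
      rw [hn]; ring
    rw [e]
    have hn4 : 1 / 4 ≤ n ^ 2 := by nlinarith
    refine hsqrt (4 * n * x₀) _ _ (by positivity) (by rw [hn]; ring)
      (fun u h1 h2 => ?_) (fun u h1 h2 => ?_)
    · have h3 : 0 < (u + x₀) * (x₀ - u) := mul_pos (by linarith) (by linarith)
      have h4 : 0 ≤ n ^ 2 * (x₀ * (u + x₀)) :=
        mul_nonneg (by linarith) (mul_nonneg hx₀.le (by linarith))
      linarith
    · have h3 : 0 ≤ (x₀ - u) * (8 * n ^ 2 * x₀ - (u + x₀)) :=
        mul_nonneg (by linarith) (by nlinarith)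
      linarith

end Periodic

lemma pos_of_hasDerivAt_pos_of_ne_zero {g : ℝ → ℝ} {v u q : ℝ} (hc : Continuous g)
    (hg : HasDerivAt g v u) (hv : 0 < v) (hu : g u = 0) (huq : u < q)
    (hne : ∀ r ∈ Ioc u q, g r ≠ 0) : 0 < g q := by
  by_contra! hq
  refine absurd (hasDerivAt_nonpos_of_le_right hg huq fun r hr => ?_) (not_le.2 hv)
  by_contra! h
  rw [hu] at h
  obtain ⟨z, hz, hz'⟩ := intermediate_value_Icc' hr.2.le hc.continuousOn
    (show (0 : ℝ) ∈ Icc (g q) (g r) from ⟨hq, h.le⟩)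
  exact hne z ⟨hr.1.trans_le hz.1, hz.2⟩ hz'


theorem limit_cycle_region (f : ℝ → ℝ) (xM xm : ℝ)
    (hf : ContDiff ℝ 2 f)
    (hxM : xM < 0) (hxm : 0 < xm)
    (hfxM : f xM = 0) (hfxm : f xm = 0)
    (hzeros : ∀ x, f x = 0 → x = xM ∨ x = xm)
    (hdM : deriv f xM < 0) (hdm : 0 < deriv f xm)
    (F : ℝ → ℝ) (hF : ∀ x, F x = ∫ s in (0:ℝ)..x, f s)
    (x₁ x₂ : ℝ) (hx₁ : x₁ < xM) (hx₂ : xm < x₂)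
    (hFx₁ : F x₁ = F xm) (hFx₂ : F x₂ = F xM)
    (hA3 : ∀ lam : ℝ, 0 < lam → ∀ x y x' y' : ℝ → ℝ,
      IsPeriodicSol f lam x y → IsPeriodicSol f lam x' y' →
      Set.range (fun t => (x t, y t)) = Set.range (fun t => (x' t, y' t)))
    (ρ : ℝ) (hρpos : 0 < ρ)
    (hρzero : (∫ s in (-1:ℝ)..1, Real.sqrt (1 - s ^ 2) * f (ρ * s)) = 0)
    (hρuniq : ∀ r : ℝ, 0 < r →
      (∫ s in (-1:ℝ)..1, Real.sqrt (1 - s ^ 2) * f (r * s)) = 0 → r = ρ) :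
    ∃ x₀ : ℝ, max ρ (max (-x₁) x₂) < x₀ ∧
      sInf (f '' Set.Icc (-x₀) x₀) < 0 ∧
      ∀ lam : ℝ, 0 < lam →
        let m := sInf (f '' Set.Icc (-x₀) x₀)
        let γ : ℝ → ℝ := fun x =>
          if lam ≤ -1 / (2 * m) then
            Real.sqrt ((x + x₀) * (x₀ - x - m * lam * (x + x₀)) / (1 + m * lam))
          else
            Real.sqrt ((x + x₀) * (x₀ - x + 8 * m ^ 2 * lam ^ 2 * x₀))
        ∀ x y : ℝ → ℝ, IsPeriodicSol f lam x y → ∀ t,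
          -x₀ < x t ∧ x t < x₀ ∧ -γ (-(x t)) < y t ∧ y t < γ (x t) := by
  have hc : Continuous f := hf.continuous
  have hd : ∀ x, HasDerivAt f (deriv f x) x :=
    fun x => (hf.differentiable (by norm_num) x).hasDerivAt
  have hd' : ∀ x, HasDerivAt (fun x => f (-x)) (-deriv f (-x)) x := fun x =>
    ((hd (-x)).comp x (hasDerivAt_neg x)).congr_deriv (by simp)
  have hright : ∀ x, xm < x → 0 < f x := fun x hx =>
    pos_of_hasDerivAt_pos_of_ne_zero hc (hd xm) hdm hfxm hx fun r hr h0 => by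
      rcases hzeros r h0 with h | h <;> linarith [hr.1]
  have hleft : ∀ x, x < xM → 0 < f x := fun x hx => by
    have := pos_of_hasDerivAt_pos_of_ne_zero (q := -x) (hc.comp continuous_neg) (hd' (-xM))
      (by simpa using hdM) (by simpa using hfxM) (by linarith) fun r hr h0 => by
        rcases hzeros (-r) h0 with h | h <;> linarith [hr.1]
    simpa using this
  have hmid : ∀ x, xM < x → x < xm → f x < 0 := fun x h1 h2 => by
    have := pos_of_hasDerivAt_pos_of_ne_zero (q := -x) (hc.comp continuous_neg).neg
      (hd' (-xm)).neg (by simpa using hdm) (by simpa using hfxm) (by linarith) fun r hr h0 => by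
        rcases hzeros (-r) (by simpa using h0) with h | h <;> linarith [hr.1, hr.2]
    simpa using this
  have hdF : ∀ x, HasDerivAt F (f x) x := fun x => by
    rw [show F = fun x => ∫ s in (0:ℝ)..x, f s from funext hF]
    exact intervalIntegral.integral_hasDerivAt_right (hc.intervalIntegrable _ _)
      (hc.stronglyMeasurableAtFilter _ _) hc.continuousAt
  have hnonneg_left : ∀ x ≤ xM, 0 ≤ f x := fun x hx => by
    rcases hx.eq_or_lt with rfl | h
    · exact hfxM.ge
    · exact (hleft x h).le
  have hnonneg_right : ∀ x, xm ≤ x → 0 ≤ f x := fun x hx => by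
    rcases hx.eq_or_lt with rfl | h
    · exact hfxm.ge
    · exact (hright x h).le
  have hnonpos : ∀ x, xM ≤ x → x ≤ xm → f x ≤ 0 := fun x h1 h2 => by
    rcases h1.eq_or_lt with rfl | h1
    · exact hfxM.le
    rcases h2.eq_or_lt with rfl | h2
    · exact hfxm.le
    exact (hmid x h1 h2).le
  have hanti : ∀ p q, xM ≤ p → p ≤ q → q ≤ xm → F q ≤ F p := fun p q h1 h2 h3 =>
    apply_le_of_hasDerivAt_nonpos h2 hdF fun t ht => hnonpos t (h1.trans ht.1) (ht.2.trans h3)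
  have hmonoL : ∀ p q, p ≤ q → q ≤ xM → F p ≤ F q := fun p q h2 h3 => by
    have := apply_le_of_hasDerivAt_nonpos (g := fun t => -F t) h2 (fun t => (hdF t).neg)
      fun t ht => by linarith [hnonneg_left t (ht.2.trans h3)]
    linarith
  have hmonoR : ∀ p q, xm ≤ p → p ≤ q → F p ≤ F q := fun p q h1 h2 => by
    have := apply_le_of_hasDerivAt_nonpos (g := fun t => -F t) h2 (fun t => (hdF t).neg)
      fun t ht => by linarith [hnonneg_right t (h1.trans ht.1)]
    linarith
  have hlt : F xm < F xM := by
    obtain ⟨ξ, hξ, hξ'⟩ := exists_hasDerivAt_eq_slope F f (hxM.trans hxm)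
      (fun r _ => (hdF r).continuousAt.continuousWithinAt) fun r _ => hdF r
    have h1 := hmid ξ hξ.1 hξ.2
    rw [hξ', div_neg_iff] at h1
    rcases h1 with h | h <;> linarith [h.1, h.2]
  have hstrip : IsDampingStrip f F (F xM) (F xm) x₁ x₂ :=
    { hasDerivAt := hdF
      neg := by linarith
      pos := by linarith
      lt := hlt
      le_b := fun x hx => hFx₁ ▸ hmonoL x x₁ hx hx₁.le
      b_le := fun x hx => by
        rcases le_total x xM with h | h
        · exact hFx₁ ▸ hmonoL x₁ x hx h
        rcases le_total x xm with h' | h'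
        · exact hanti x xm h h' le_rfl
        · exact hmonoR xm x le_rfl h'
      le_a := fun x hx => by
        rcases le_total x xM with h | h
        · exact hmonoL x xM h le_rfl
        rcases le_total x xm with h' | h'
        · exact hanti xM x le_rfl h h'
        · exact hFx₂ ▸ hmonoR x x₂ h' hx
      a_le := fun x hx => hFx₂ ▸ hmonoR x₂ x hx₂.le hx
      nonneg_left := fun x hx => hnonneg_left x (hx.trans hx₁.le)
      nonneg_right := fun x hx => hnonneg_right x (hx₂.le.trans hx) }
  obtain ⟨x₀, hx₀⟩ := exists_gt (max (max ρ (max (-x₁) x₂)) (2 * (x₂ - x₁) + (x₂ - x₁)))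
  rw [max_lt_iff] at hx₀
  obtain ⟨hx₀, hx₀'⟩ := hx₀
  have hx₀pos : 0 < x₀ := by linarith
  have hbdd : BddBelow (f '' Set.Icc (-x₀) x₀) :=
    (isCompact_Icc.image hc).bddBelow
  have hm : ∀ u, -x₀ ≤ u → u ≤ x₀ → sInf (f '' Set.Icc (-x₀) x₀) ≤ f u :=
    fun u h1 h2 => csInf_le hbdd ⟨u, ⟨h1, h2⟩, rfl⟩
  have hm0 : sInf (f '' Set.Icc (-x₀) x₀) < 0 :=
    (hm 0 (by linarith) hx₀pos.le).trans_lt (hmid 0 hxM hxm)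
  refine ⟨x₀, hx₀, hm0, fun lam hlam => ?_⟩
  intro m γ x y hsol t
  have hxb : ∀ t, -x₀ < x t ∧ x t < x₀ := fun t => by
    have h1 := hstrip.le_amplitude hlam hsol t
    have h2 := hstrip.reflect.le_amplitude hlam hsol.reflect t
    constructor <;> linarith
  refine ⟨(hxb t).1, (hxb t).2, ?_, hsol.lt_sqrt_barrier hlam hx₀pos hxb hm hm0 t⟩
  exact neg_lt.1 (hsol.reflect.lt_sqrt_barrier hlam hx₀pos
    (fun t => ⟨by linarith [(hxb t).2], by linarith [(hxb t).1]⟩)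
    (fun u h1 h2 => hm (-u) (by linarith) (by linarith)) hm0 t)
end
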